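/- Suppose a ∈ X^k is such that Γ_k is a Lipschitz triangulable curve and Γ_k equals its own polynomially convex hull. Then a is a universal center if and only if the path A_k is a loop (A_k(0)=A_k(T)) and, regarded as a loop in the topological subspace Γ_k ⊂ ℂ^k, it is homotopic in Γ_k to a constant loop (it represents the unit element of π₁(Γ_k)). -/

import Mathlib

open MeasureTheory

noncomputable section

/-- The class `X`: sequences `a = (a₁, a₂, …)` of bounded measurable functions on `[0,T]`
with `sup_{x,i} |aᵢ(x)|^{1/i} < ∞` (equivalently `‖aᵢ(x)‖ ≤ Cⁱ` for some `C`).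
We index by `ℕ`, using only indices `i ≥ 1`. -/
def MemX (T : ℝ) (a : ℕ → ℝ → ℂ) : Prop :=
  (∀ i, Measurable (a i)) ∧
    ∃ C : ℝ, ∀ i : ℕ, 1 ≤ i → ∀ x ∈ Set.Icc (0 : ℝ) T, ‖a i x‖ ≤ C ^ i

/-- Auxiliary iterated integral: for the multi-index list `[j₁, …, jₖ]` (outermost first),
`itIntAux a [j₁,…,jₖ] x = ∫_{0 ≤ s_k ≤ … ≤ s_1 ≤ x} a_{j₁}(s₁)⋯a_{jₖ}(sₖ) ds`. -/
def itIntAux (a : ℕ → ℝ → ℂ) : List ℕ → ℝ → ℂ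
  | [], _ => 1
  | i :: l, x => ∫ s in (0 : ℝ)..x, a i s * itIntAux a l s

/-- The basic iterated integral `I_{i₁,…,iₖ}(a)` over `0 ≤ s₁ ≤ ⋯ ≤ sₖ ≤ T`,
with the multi-index encoded as the list `[i₁, …, iₖ]` (so the empty list gives `1`). -/
def itInt (T : ℝ) (a : ℕ → ℝ → ℂ) (l : List ℕ) : ℂ :=
  itIntAux a l.reverse T

/-- `a` is a universal center: every basic iterated integral of positive order vanishes
at `a`. -/
def IsUnivCenter (T : ℝ) (a : ℕ → ℝ → ℂ) : Prop :=
  ∀ l : List ℕ, l ≠ [] → (∀ i ∈ l, 1 ≤ i) → itInt T a l = 0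

/-- The Lipschitz path `A_k : [0,T] → ℂᵏ`, `A_k(x) = (∫₀ˣ a₁, …, ∫₀ˣ a_k)`. -/
def pathA (T : ℝ) (a : ℕ → ℝ → ℂ) (k : ℕ) : ℝ → (Fin k → ℂ) := fun x j =>
  ∫ t in (0 : ℝ)..x, a (j.1 + 1) t

/-- The polynomially convex hull of a set `K ⊆ ℂᵏ`: all `z` such that
`|p(z)| ≤ max_{w ∈ K} |p(w)|` for every holomorphic polynomial `p` in `k` variables. -/
def polyHull {k : ℕ} (K : Set (Fin k → ℂ)) : Set (Fin k → ℂ) :=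
  {z | ∀ p : MvPolynomial (Fin k) ℂ, ∀ M : ℝ,
    (∀ w ∈ K, ‖MvPolynomial.eval w p‖ ≤ M) → ‖MvPolynomial.eval z p‖ ≤ M}

/-- A compact curve `C ⊆ ℂᵏ (≅ ℝ^{2k})` is Lipschitz triangulable: `C = ⋃_{j=1}^s C_j`
where distinct `C_i ∩ C_j` contain at most one point, each `C_j` is the image of a
Lipschitz embedding `f_j : [0,1] → ℂᵏ`, and the inverse maps `f_j⁻¹ : C_j → ℝ` are
locally Lipschitz on `C_j` away from the endpoints `f_j(0), f_j(1)`. -/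
def LipTriangulable {k : ℕ} (C : Set (Fin k → ℂ)) : Prop :=
  ∃ (s : ℕ) (f : Fin s → ℝ → (Fin k → ℂ)) (g : Fin s → (Fin k → ℂ) → ℝ),
    C = (⋃ j, f j '' Set.Icc 0 1) ∧
    (∀ i j, i ≠ j → Set.Subsingleton (f i '' Set.Icc 0 1 ∩ f j '' Set.Icc 0 1)) ∧
    (∀ j, ∃ K : NNReal, LipschitzOnWith K (f j) (Set.Icc 0 1)) ∧
    (∀ j, Set.InjOn (f j) (Set.Icc 0 1)) ∧
    (∀ j, ∀ x ∈ Set.Icc (0 : ℝ) 1, g j (f j x) = x) ∧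
    (∀ j, ∀ y ∈ f j '' Set.Icc 0 1, y ≠ f j 0 → y ≠ f j 1 →
      ∃ ε > (0 : ℝ), ∃ K : NNReal,
        LipschitzOnWith K (g j) (f j '' Set.Icc 0 1 ∩ Metric.ball y ε))

noncomputable section
namespace UC
open Set Filter Topology

lemma ftc {φ ψ : ℝ → ℂ} {s t : ℝ} {K : NNReal} (hφ : LipschitzOnWith K φ (uIcc s t))
    (hd : ∀ᵐ r, r ∈ uIcc s t → HasDerivAt φ (ψ r) r) (hψ : IntervalIntegrable ψ volume s t) :
    ∫ r in s..t, ψ r = φ t - φ s := by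
  have hre : LipschitzOnWith K (fun r => (φ r).re) (uIcc s t) := by
    intro x hx y hy
    refine le_trans ?_ (hφ hx hy)
    rw [edist_dist, edist_dist]
    apply ENNReal.ofReal_le_ofReal
    rw [Real.dist_eq, dist_eq_norm, ← Complex.sub_re]
    exact Complex.abs_re_le_norm _
  have him : LipschitzOnWith K (fun r => (φ r).im) (uIcc s t) := by
    intro x hx y hy
    refine le_trans ?_ (hφ hx hy)
    rw [edist_dist, edist_dist]
    apply ENNReal.ofReal_le_ofReal
    rw [Real.dist_eq, dist_eq_norm, ← Complex.sub_im]
    exact Complex.abs_im_le_norm _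
  have h1 := hre.absolutelyContinuousOnInterval.integral_deriv_eq_sub
  have h2 := him.absolutelyContinuousOnInterval.integral_deriv_eq_sub
  have e1 : ∫ r in s..t, deriv (fun r => (φ r).re) r = ∫ r in s..t, (ψ r).re := by
    apply intervalIntegral.integral_congr_ae
    filter_upwards [hd] with r hr hm
    exact (Complex.reCLM.hasFDerivAt.comp_hasDerivAt r (hr (uIoc_subset_uIcc hm))).deriv
  have e2 : ∫ r in s..t, deriv (fun r => (φ r).im) r = ∫ r in s..t, (ψ r).im := by
    apply intervalIntegral.integral_congr_ae
    filter_upwards [hd] with r hr hm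
    exact (Complex.imCLM.hasFDerivAt.comp_hasDerivAt r (hr (uIoc_subset_uIcc hm))).deriv
  have f1 := Complex.reCLM.intervalIntegral_comp_comm hψ
  have f2 := Complex.imCLM.intervalIntegral_comp_comm hψ
  simp only [Complex.reCLM_apply, Complex.imCLM_apply] at f1 f2
  apply Complex.ext
  · rw [← f1, ← e1, h1]; simp
  · rw [← f2, ← e2, h2]; simp

lemma lip_bound {f : ℝ → ℂ} {K : NNReal} (hf : LipschitzWith K f) (v : ℝ) : ‖deriv f v‖ ≤ K :=
  norm_deriv_le_of_lipschitz hf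

lemma ii_of_bdd {g : ℝ → ℂ} (hg : Measurable g) {C : ℝ} (hC : ∀ t, ‖g t‖ ≤ C) (s t : ℝ) :
    IntervalIntegrable g volume s t := by
  refine (intervalIntegrable_const (c := C)).mono_fun hg.aestronglyMeasurable ?_
  filter_upwards with x
  exact (hC x).trans (le_abs_self C)

lemma ii_deriv {f : ℝ → ℂ} {K : NNReal} (hf : LipschitzWith K f) (s t : ℝ) :
    IntervalIntegrable (deriv f) volume s t :=
  ii_of_bdd (measurable_deriv f) (lip_bound hf) s t

lemma ftc_lip {f : ℝ → ℂ} {K : NNReal} (hf : LipschitzWith K f) (s t : ℝ) :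
    ∫ r in s..t, deriv f r = f t - f s := by
  refine ftc (hf.lipschitzOnWith) ?_ (ii_deriv hf s t)
  filter_upwards [hf.ae_differentiableAt_real] with r hr _
  exact hr.hasDerivAt

lemma loc_int {g : ℝ → ℂ} (hg : ∀ s t, IntervalIntegrable g volume s t) :
    LocallyIntegrable g volume := by
  intro x
  refine ⟨Ioc (x-1) (x+1), Ioc_mem_nhds (by linarith) (by linarith), ?_⟩
  exact (intervalIntegrable_iff_integrableOn_Ioc_of_le (by linarith)).1 (hg _ _)

/-- change of variables -/
lemma chain {f F α : ℝ → ℂ} {u : ℝ → ℝ} {K Ku : NNReal} {s t : ℝ}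
    (hf : LipschitzWith K f) (hF : Continuous F) (N : Set ℝ) (hN : IsOpen N)
    (hst : uIcc s t ⊆ N)
    (hu : LipschitzOnWith Ku u N) (hα : ∀ s t, IntervalIntegrable α volume s t)
    (hφ : ∀ r ∈ N, ∫ x in (0:ℝ)..r, α x = f (u r)) :
    ∫ v in u s..u t, F v * deriv f v = ∫ r in s..t, F (u r) * α r := by
  have hFi : ∀ a b, IntervalIntegrable (fun v => F v * deriv f v) volume a b := fun a b =>
    (ii_deriv hf a b).continuousOn_mul hF.continuousOn
  set G : ℝ → ℂ := fun v => ∫ x in (0:ℝ)..v, F x * deriv f x with hG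
  have hGd : ∀ v w, G w - G v = ∫ x in v..w, F x * deriv f x := by
    intro v w
    simp only [hG]
    rw [intervalIntegral.integral_interval_sub_left (hFi _ _) (hFi _ _)]
  rw [← hGd]
  symm
  have huc : ContinuousOn u (uIcc s t) := (hu.mono hst).continuousOn
  obtain ⟨R, hR⟩ := (isCompact_uIcc.image_of_continuousOn huc).isBounded.subset_closedBall (0:ℝ)
  obtain ⟨C, hC⟩ := (isCompact_closedBall (0:ℝ) R).exists_bound_of_continuousOn hF.continuousOn
  have hmem : ∀ r ∈ uIcc s t, u r ∈ Metric.closedBall (0:ℝ) R := fun r hr =>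
    hR (mem_image_of_mem u hr)
  have hmain := ftc (φ := fun r => G (u r)) (ψ := fun r => F (u r) * α r) (s := s) (t := t)
    (K := (Real.toNNReal C * K) * Ku) ?_ ?_ ?_
  · exact hmain
  · intro x hx y hy
    have h1 : dist (G (u x)) (G (u y)) ≤ (max C 0 * K) * dist (u x) (u y) := by
      rw [dist_comm, dist_eq_norm, hGd, dist_comm, Real.dist_eq]
      apply intervalIntegral.norm_integral_le_of_norm_le_const
      intro v hv
      have : v ∈ Metric.closedBall (0:ℝ) R :=
        (convex_closedBall (0:ℝ) R).ordConnected.uIcc_subset (hmem x hx) (hmem y hy)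
          (uIoc_subset_uIcc hv)
      rw [norm_mul]
      gcongr
      · exact (hC v this).trans (le_max_left _ _)
      · exact lip_bound hf v
    have h2 : dist (u x) (u y) ≤ Ku * dist x y := hu.dist_le_mul _ (hst hx) _ (hst hy)
    rw [edist_dist, edist_dist]
    rw [← ENNReal.ofReal_coe_nnreal, ← ENNReal.ofReal_mul (by positivity)]
    apply ENNReal.ofReal_le_ofReal
    refine h1.trans ?_
    push_cast
    rw [Real.coe_toNNReal', mul_assoc (max C 0 * (K:ℝ))]
    gcongr
  · filter_upwards [_root_.LocallyIntegrable.ae_hasDerivAt_integral (loc_int hα)] with r hr hm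
    have hA := hr 0
    have hrN := hst hm
    have hNn : N ∈ 𝓝 r := hN.mem_nhds hrN
    have hfu : HasDerivAt (fun x => f (u x)) (α r) r := by
      refine hA.congr_of_eventuallyEq ?_
      filter_upwards [hNn] with x hx
      exact (hφ x hx).symm
    have h3 : HasDerivAt (fun x => F (u r) * f (u x)) (F (u r) * α r) r := hfu.const_mul _
    have h4 : HasDerivAt (fun x => G (u x) - F (u r) * f (u x)) 0 r := by
      rw [hasDerivAt_iff_isLittleO]
      rw [Asymptotics.isLittleO_iff]
      intro c hc
      have huN : ContinuousAt u r := hu.continuousOn.continuousAt hNn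
      set ε := c / (K * Ku + 1) with hε
      have hεp : 0 < ε := by positivity
      obtain ⟨δ, hδ, hFδ⟩ := Metric.continuousAt_iff.1 (hF.continuousAt (x := u r)) ε hεp
      have := huN.eventually (Metric.ball_mem_nhds (u r) hδ)
      filter_upwards [hNn, this] with x hx hux
      have e1 : G (u x) - F (u r) * f (u x) - (G (u r) - F (u r) * f (u r)) - (x - r) • (0:ℂ)
          = ∫ v in u r..u x, (F v - F (u r)) * deriv f v := by
        have e2 : ∫ v in u r..u x, (F v - F (u r)) * deriv f v
          = (∫ v in u r..u x, F v * deriv f v) - ∫ v in u r..u x, F (u r) * deriv f v := by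
          rw [← intervalIntegral.integral_sub (hFi _ _) ((ii_deriv hf _ _).const_mul _)]
          congr 1; ext v; ring
        rw [e2, intervalIntegral.integral_const_mul, ftc_lip hf, ← hGd]
        simp; ring
      rw [e1]
      have h5 : ‖∫ v in u r..u x, (F v - F (u r)) * deriv f v‖ ≤ (ε * K) * |u x - u r| := by
        apply intervalIntegral.norm_integral_le_of_norm_le_const
        intro v hv
        rw [norm_mul]
        gcongr
        · rw [← dist_eq_norm]
          refine (hFδ ?_).le
          have := (convex_ball (u r) δ).ordConnected.uIcc_subset (Metric.mem_ball_self hδ) hux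
            (uIoc_subset_uIcc hv)
          exact this
        · exact lip_bound hf v
      refine h5.trans ?_
      have h6 : |u x - u r| ≤ Ku * ‖x - r‖ := by
        have := hu.dist_le_mul _ hx _ hrN
        rwa [Real.dist_eq, Real.dist_eq] at this
      calc ε * K * |u x - u r| ≤ ε * K * (Ku * ‖x - r‖) := by gcongr
        _ = (c * ((K * Ku) / (K * Ku + 1))) * ‖x - r‖ := by rw [hε]; ring
        _ ≤ (c * 1) * ‖x - r‖ := by
          gcongr
          rw [div_le_one (by positivity)]
          linarith
        _ = c * ‖x - r‖ := by ring
    have h7 := h4.add h3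
    convert! h7 using 1
    · ext x; simp
    · simp
  · exact (hα s t).continuousOn_mul (hF.comp_continuousOn huc)

end UC
end

noncomputable section
namespace UC
open Set Filter Topology

def sol (β : ℕ → ℝ → ℂ) (v0 : ℝ) (x : ℕ → ℂ) : ℕ → ℝ → ℂ
  | 0, _ => x 0
  | p + 1, v => x (p + 1) + ∫ r in v0..v, β p r * sol β v0 x p r

def Nice (β : ℕ → ℝ → ℂ) : Prop := ∀ p, Measurable (β p) ∧ ∃ C : ℝ, ∀ t, ‖β p t‖ ≤ C

lemma Nice.ii {β : ℕ → ℝ → ℂ} (h : Nice β) (p : ℕ) (s t : ℝ) :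
    IntervalIntegrable (β p) volume s t := by
  obtain ⟨hm, C, hC⟩ := h p
  exact ii_of_bdd hm hC s t

lemma sol_cont {β : ℕ → ℝ → ℂ} (h : Nice β) (v0 : ℝ) (x : ℕ → ℂ) (p : ℕ) :
    Continuous (sol β v0 x p) := by
  induction p with
  | zero => exact continuous_const
  | succ p ih =>
    refine continuous_const.add ?_
    exact intervalIntegral.continuous_primitive
      (fun a b => (h.ii p a b).mul_continuousOn ih.continuousOn) v0

lemma sol_ii {β : ℕ → ℝ → ℂ} (h : Nice β) (v0 : ℝ) (x : ℕ → ℂ) (p : ℕ) (s t : ℝ) :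
    IntervalIntegrable (fun r => β p r * sol β v0 x p r) volume s t :=
  (h.ii p s t).mul_continuousOn (sol_cont h v0 x p).continuousOn

lemma sol_self (β : ℕ → ℝ → ℂ) (v0 : ℝ) (x : ℕ → ℂ) (p : ℕ) : sol β v0 x p v0 = x p := by
  cases p <;> simp [sol]

lemma sol_unique {β : ℕ → ℝ → ℂ} (s : ℝ) (S : Set ℝ) (hS : S.OrdConnected) (hs : s ∈ S)
    (z : ℕ → ℝ → ℂ) (h0 : ∀ t ∈ S, z 0 t = z 0 s)
    (h1 : ∀ p, ∀ t ∈ S, z (p+1) t = z (p+1) s + ∫ r in s..t, β p r * z p r) (p : ℕ) :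
    ∀ t ∈ S, sol β s (fun p => z p s) p t = z p t := by
  induction p with
  | zero => intro t ht; simp [sol, h0 t ht]
  | succ p ih =>
    intro t ht
    rw [h1 p t ht, sol]
    congr 1
    apply intervalIntegral.integral_congr
    intro r hr
    simp only
    rw [ih r (hS.uIcc_subset hs ht hr)]

lemma sol_sol {β : ℕ → ℝ → ℂ} (h : Nice β) (v0 v1 : ℝ) (x : ℕ → ℂ) (p : ℕ) (v : ℝ) :
    sol β v1 (fun p => sol β v0 x p v1) p v = sol β v0 x p v := by
  refine sol_unique v1 univ ordConnected_univ (mem_univ _) (sol β v0 x) (fun t _ => rfl) ?_ p v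
    (mem_univ _)
  intro p t _
  rw [sol, sol, add_assoc,
    intervalIntegral.integral_add_adjacent_intervals (sol_ii h _ _ _ _ _) (sol_ii h _ _ _ _ _)]

def Tr {β : ℕ → ℝ → ℂ} (h : Nice β) (u v : ℝ) : Equiv.Perm (ℕ → ℂ) where
  toFun x := fun p => sol β u x p v
  invFun x := fun p => sol β v x p u
  left_inv x := by ext p; simp only; rw [sol_sol h, sol_self]
  right_inv x := by ext p; simp only; rw [sol_sol h, sol_self]

lemma Tr_apply {β : ℕ → ℝ → ℂ} (h : Nice β) (u v : ℝ) (x : ℕ → ℂ) (p : ℕ) :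
    Tr h u v x p = sol β u x p v := rfl

lemma Tr_mul {β : ℕ → ℝ → ℂ} (h : Nice β) (u v w : ℝ) : Tr h v w * Tr h u v = Tr h u w := by
  ext x p
  exact sol_sol h u v x p w

lemma Tr_self {β : ℕ → ℝ → ℂ} (h : Nice β) (u : ℝ) : Tr h u u = 1 := by
  ext x p
  exact sol_self β u x p

lemma Tr_inv {β : ℕ → ℝ → ℂ} (h : Nice β) (u v : ℝ) : (Tr h u v)⁻¹ = Tr h v u := by
  rw [inv_eq_iff_mul_eq_one, Tr_mul, Tr_self]

/-- If the coefficients vanish between `u` and `v` then the transport is trivial. -/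
lemma Tr_eq_one {β : ℕ → ℝ → ℂ} (h : Nice β) (u v : ℝ)
    (h0 : ∀ p, ∀ r ∈ uIcc u v, β p r = 0) : Tr h u v = 1 := by
  ext x p
  change sol β u x p v = x p
  refine sol_unique u (uIcc u v) ordConnected_uIcc left_mem_uIcc (fun p _ => x p)
    (fun _ _ => rfl) ?_ p v right_mem_uIcc
  intro p t ht
  rw [intervalIntegral.integral_congr (g := fun _ => 0)]
  · simp
  · intro r hr
    simp only
    rw [h0 p r (uIcc_subset_uIcc left_mem_uIcc ht hr), zero_mul]

lemma sol_tendsto {βn : ℕ → ℕ → ℝ → ℂ} {β : ℕ → ℝ → ℂ} (hn : ∀ n, Nice (βn n))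
    (C : ℕ → ℝ) (hC : ∀ n p t, ‖βn n p t‖ ≤ C p)
    (hlim : ∀ p, ∀ᵐ t, Tendsto (fun n => βn n p t) atTop (𝓝 (β p t)))
    (v0 : ℝ) (x : ℕ → ℂ) (p : ℕ) :
    ∀ v, Tendsto (fun n => sol (βn n) v0 x p v) atTop (𝓝 (sol β v0 x p v)) := by
  have hbd : ∀ p R, ∃ D : ℝ, ∀ n, ∀ v ∈ uIcc v0 R, ‖sol (βn n) v0 x p v‖ ≤ D := by
    intro p R
    induction p with
    | zero => exact ⟨‖x 0‖, fun n v _ => le_rfl⟩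
    | succ p ih =>
      obtain ⟨D, hD⟩ := ih
      refine ⟨‖x (p+1)‖ + |C p| * |D| * |R - v0|, ?_⟩
      intro n v hv
      rw [sol]
      refine (norm_add_le _ _).trans ?_
      gcongr
      refine (intervalIntegral.norm_integral_le_of_norm_le_const (C := |C p| * |D|) ?_).trans ?_
      · intro r hr
        rw [norm_mul]
        gcongr
        · exact (hC n p r).trans (le_abs_self _)
        · exact (hD n r (uIcc_subset_uIcc left_mem_uIcc hv (uIoc_subset_uIcc hr))).trans
            (le_abs_self _)
      · gcongr ?_ * ?_
        exact abs_sub_left_of_mem_uIcc hv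
  induction p with
  | zero => intro v; exact tendsto_const_nhds
  | succ p ih =>
    intro v
    simp only [sol]
    refine tendsto_const_nhds.add ?_
    obtain ⟨D, hD⟩ := hbd p v
    refine intervalIntegral.tendsto_integral_filter_of_dominated_convergence (fun _ => |C p| * |D|)
      ?_ ?_ ?_ ?_
    · filter_upwards with n
      exact (((hn n p).1).mul (sol_cont (hn n) v0 x p).measurable).aestronglyMeasurable
    · filter_upwards with n
      filter_upwards with r hr
      rw [norm_mul]
      gcongr
      · exact (hC n p r).trans (le_abs_self _)
      · exact (hD n r (uIoc_subset_uIcc hr)).trans (le_abs_self _)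
    · exact intervalIntegrable_const
    · filter_upwards [hlim p] with r hr _
      exact hr.mul (ih r)

variable {k : ℕ}

def PA (α : Fin k → ℝ → ℂ) (t : ℝ) : Fin k → ℂ := fun i => ∫ r in (0:ℝ)..t, α i r

def pull (h : ℕ → Fin k → (Fin k → ℂ) → ℂ) (f : ℝ → Fin k → ℂ) (p : ℕ) (v : ℝ) : ℂ :=
  ∑ i, h p i (f v) * deriv (fun v => f v i) v

def bform (h : ℕ → Fin k → (Fin k → ℂ) → ℂ) (α : Fin k → ℝ → ℂ) (p : ℕ) (t : ℝ) : ℂ :=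
  ∑ i, h p i (PA α t) * α i t

lemma lip_comp {f : ℝ → Fin k → ℂ} {K : NNReal} (hf : LipschitzWith K f) (i : Fin k) :
    LipschitzWith K (fun v => f v i) := by
  intro x y
  exact (edist_le_pi_edist (f x) (f y) i).trans (hf x y)

lemma transfer {α : Fin k → ℝ → ℂ} {h : ℕ → Fin k → (Fin k → ℂ) → ℂ} {f : ℝ → Fin k → ℂ}
    {K Ku : NNReal} (hα : ∀ i s t, IntervalIntegrable (α i) volume s t)
    (hf : LipschitzWith K f) (hhf : ∀ p i, Continuous (fun v => h p i (f v)))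
    (hN1 : Nice (pull h f)) (hN2 : Nice (bform h α))
    {N : Set ℝ} (hN : IsOpen N) (hNo : N.OrdConnected) {u : ℝ → ℝ} (hu : LipschitzOnWith Ku u N)
    (hA : ∀ r ∈ N, PA α r = f (u r)) {s t : ℝ} (hs : s ∈ N) (ht : t ∈ N) :
    Tr hN2 s t = Tr hN1 (u s) (u t) := by
  ext x p
  change sol (bform h α) s x p t = sol (pull h f) (u s) x p (u t)
  have key := sol_unique (β := bform h α) s N hNo hs (fun p r => sol (pull h f) (u s) x p (u r))
    (fun _ _ => rfl) ?_ p t ht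
  · simp only [sol_self] at key
    exact key
  · intro p t ht
    rw [sol_self, sol]
    congr 1
    have hst : uIcc s t ⊆ N := hNo.uIcc_subset hs ht
    have huc : ContinuousOn u (uIcc s t) := (hu.mono hst).continuousOn
    have hcont : ∀ i, Continuous (fun v => h p i (f v) * sol (pull h f) (u s) x p v) := fun i =>
      (hhf p i).mul (sol_cont hN1 _ _ _)
    have e1 : ∫ r in u s..u t, pull h f p r * sol (pull h f) (u s) x p r
        = ∑ i, ∫ v in u s..u t, (h p i (f v) * sol (pull h f) (u s) x p v)
            * deriv (fun v => f v i) v := by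
      rw [← intervalIntegral.integral_finsetSum]
      · congr 1; ext v
        rw [pull, Finset.sum_mul]
        refine Finset.sum_congr rfl fun i _ => by ring
      · intro i _
        exact (ii_deriv (lip_comp hf i) _ _).continuousOn_mul (hcont i).continuousOn
    have e2 : ∫ r in s..t, bform h α p r * sol (pull h f) (u s) x p (u r)
        = ∑ i, ∫ r in s..t, (h p i (f (u r)) * sol (pull h f) (u s) x p (u r)) * α i r := by
      rw [← intervalIntegral.integral_finsetSum]
      · apply intervalIntegral.integral_congr
        intro r hr
        simp only
        rw [bform, Finset.sum_mul, hA r (hst hr)]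
        refine Finset.sum_congr rfl fun i _ => by ring
      · intro i _
        exact (hα i s t).continuousOn_mul ((hcont i).comp_continuousOn huc)
    rw [e1, e2]
    refine Finset.sum_congr rfl fun i _ => ?_
    refine chain (lip_comp hf i) (hcont i) N hN hst hu (hα i) ?_
    intro r hr
    have := congrFun (hA r hr) i
    exact this

end UC
end

noncomputable section
namespace UC
open Set Filter Topology

def cl (v : ℝ) : ℝ := max 0 (min 1 v)

lemma cl_mem (v : ℝ) : cl v ∈ Icc (0:ℝ) 1 := by
  unfold cl; constructor
  · exact le_max_left _ _
  · exact max_le zero_le_one (min_le_left _ _)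

lemma cl_of_mem {v : ℝ} (hv : v ∈ Icc (0:ℝ) 1) : cl v = v := by
  unfold cl; rw [min_eq_right hv.2, max_eq_right hv.1]

lemma cl_lip : LipschitzWith 1 cl := by
  unfold cl
  exact (LipschitzWith.id.const_min 1).const_max 0

structure Gr {k : ℕ} (Γ : Set (Fin k → ℂ)) (p₀ : Fin k → ℂ) where
  E : Type
  [fin : Fintype E]
  [dec : DecidableEq E]
  f : E → ℝ → (Fin k → ℂ)
  lip : ∀ e, ∃ K : NNReal, LipschitzWith K (f e)
  clamp : ∀ e v, f e v = f e (cl v)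
  inj : ∀ e, InjOn (f e) (Icc 0 1)
  cover : Γ = ⋃ e, f e '' Icc 0 1
  meet : ∀ e e' u u', e ≠ e' → u ∈ Icc (0:ℝ) 1 → u' ∈ Icc (0:ℝ) 1 → f e u = f e' u' →
    u = 0 ∨ u = 1
  base : ∀ e, ∀ u ∈ Icc (0:ℝ) 1, f e u = p₀ → u = 0 ∨ u = 1
  inv : ∀ e, ∀ u ∈ Ioo (0:ℝ) 1, ∃ ε > (0:ℝ), ∃ K : NNReal, ∀ u₁ ∈ Icc (0:ℝ) 1, ∀ u₂ ∈ Icc (0:ℝ) 1,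
    dist (f e u₁) (f e u) < ε → dist (f e u₂) (f e u) < ε →
      |u₁ - u₂| ≤ K * dist (f e u₁) (f e u₂)

lemma exists_gr {k : ℕ} {Γ : Set (Fin k → ℂ)} (p₀ : Fin k → ℂ) (h : LipTriangulable Γ) :
    Nonempty (Gr Γ p₀) := by
  classical
  obtain ⟨s, f, g, hcov, hsub, hlip, hinj, hg, hinv⟩ := h
  let P : Fin s → Set ℝ := fun j => {0, 1} ∪ ({u | u ∈ Icc (0:ℝ) 1 ∧ f j u = p₀} ∪
    ⋃ i, {u | i ≠ j ∧ u ∈ Icc (0:ℝ) 1 ∧ f j u ∈ f i '' Icc 0 1})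
  have hPfin : ∀ j, (P j).Finite := by
    intro j
    refine (Set.toFinite _).union (Set.Finite.union ?_ ?_)
    · apply Set.Subsingleton.finite
      intro u hu v hv
      exact hinj j hu.1 hv.1 (hu.2.trans hv.2.symm)
    · apply Set.finite_iUnion
      intro i
      apply Set.Subsingleton.finite
      intro u hu v hv
      refine hinj j hu.2.1 hv.2.1 ?_
      exact hsub i j hu.1 ⟨hu.2.2, mem_image_of_mem _ hu.2.1⟩ ⟨hv.2.2, mem_image_of_mem _ hv.2.1⟩
  have hP0 : ∀ j, (0:ℝ) ∈ P j := fun j => Or.inl (by simp)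
  have hP1 : ∀ j, (1:ℝ) ∈ P j := fun j => Or.inl (by simp)
  have hPI : ∀ j, P j ⊆ Icc 0 1 := by
    intro j u hu
    rcases hu with hu | hu | hu
    · rcases hu with rfl | hu
      · simp
      · rw [mem_singleton_iff] at hu; subst hu; simp
    · exact hu.1
    · obtain ⟨i, hi⟩ := mem_iUnion.1 hu
      exact hi.2.1
  let S : Set (Fin s × ℝ × ℝ) := {x | x.2.1 ∈ P x.1 ∧ x.2.2 ∈ P x.1 ∧ x.2.1 < x.2.2 ∧
    ∀ w ∈ P x.1, ¬ (x.2.1 < w ∧ w < x.2.2)}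
  have hSfin : S.Finite := by
    have : (⋃ j : Fin s, ({j} : Set (Fin s)) ×ˢ (P j ×ˢ P j)).Finite := by
      apply Set.finite_iUnion
      intro j
      exact (Set.finite_singleton j).prod ((hPfin j).prod (hPfin j))
    refine this.subset ?_
    rintro ⟨j, a, b⟩ hx
    exact mem_iUnion.2 ⟨j, by simp, hx.1, hx.2.1⟩
  haveI := hSfin.fintype
  -- affine parameter
  let w : S → ℝ → ℝ := fun e v => e.1.2.1 + (e.1.2.2 - e.1.2.1) * v
  have hwI : ∀ e : S, ∀ v ∈ Icc (0:ℝ) 1, w e v ∈ Icc e.1.2.1 e.1.2.2 := by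
    intro e v hv
    have := e.2.2.2.1
    constructor
    · simp only [w]; nlinarith [hv.1]
    · simp only [w]; nlinarith [hv.2]
  have hwII : ∀ e : S, ∀ v ∈ Icc (0:ℝ) 1, w e v ∈ Icc (0:ℝ) 1 := by
    intro e v hv
    have h1 := hwI e v hv
    exact ⟨(hPI _ e.2.1).1.trans h1.1, h1.2.trans (hPI _ e.2.2.1).2⟩
  have hwO : ∀ e : S, ∀ v ∈ Icc (0:ℝ) 1, w e v ∈ P e.1.1 → v = 0 ∨ v = 1 := by
    intro e v hv hP
    have := e.2.2.2.1
    by_contra hcon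
    push Not at hcon
    have hv0 : 0 < v := lt_of_le_of_ne hv.1 (Ne.symm hcon.1)
    have hv1 : v < 1 := lt_of_le_of_ne hv.2 hcon.2
    refine e.2.2.2.2 _ hP ⟨?_, ?_⟩
    · simp only [w]; nlinarith
    · simp only [w]; nlinarith
  have hwE : ∀ e : S, ∀ v, v = 0 ∨ v = 1 → w e v ∈ P e.1.1 := by
    rintro e v (rfl | rfl)
    · simpa [w] using e.2.1
    · simpa [w] using e.2.2.1
  refine ⟨{ E := S, f := fun e v => f e.1.1 (w e (cl v)), lip := ?_, clamp := ?_, inj := ?_,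
            cover := ?_, meet := ?_, base := ?_, inv := ?_ }⟩
  · intro e
    obtain ⟨K, hK⟩ := hlip e.1.1
    have hw : LipschitzWith (Real.toNNReal (e.1.2.2 - e.1.2.1)) (w e) := by
      apply LipschitzWith.of_dist_le_mul
      intro x y
      rw [Real.coe_toNNReal _ (by linarith [e.2.2.2.1]), Real.dist_eq, Real.dist_eq]
      simp only [w]
      rw [show e.1.2.1 + (e.1.2.2 - e.1.2.1) * x - (e.1.2.1 + (e.1.2.2 - e.1.2.1) * y)
        = (e.1.2.2 - e.1.2.1) * (x - y) by ring, abs_mul, abs_of_pos (by linarith [e.2.2.2.1])]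
    have h1 := hw.comp cl_lip
    refine ⟨_, lipschitzOnWith_univ.1 (hK.comp h1.lipschitzOnWith ?_)⟩
    intro v _
    exact hwII e _ (cl_mem v)
  · intro e v
    simp only [cl_of_mem (cl_mem v)]
  · intro e x hx y hy hxy
    simp only [cl_of_mem hx, cl_of_mem hy] at hxy
    have := hinj _ (hwII e x hx) (hwII e y hy) hxy
    simp only [w] at this
    have h2 : 0 < e.1.2.2 - e.1.2.1 := by linarith [e.2.2.2.1]
    have h3 : (e.1.2.2 - e.1.2.1) * x = (e.1.2.2 - e.1.2.1) * y := by linarith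
    exact mul_left_cancel₀ h2.ne' h3
  · rw [hcov]
    ext z
    simp only [mem_iUnion, mem_image]
    constructor
    · rintro ⟨j, u, hu, rfl⟩
      let P1 : Finset ℝ := (hPfin j).toFinset.filter (fun x => x ≤ u ∧ x < 1)
      have hP1n : P1.Nonempty := ⟨0, by simp [P1, hP0 j, hu.1]⟩
      set a := P1.max' hP1n with ha
      have ham : a ∈ P1 := P1.max'_mem hP1n
      simp only [P1, Finset.mem_filter, Set.Finite.mem_toFinset] at ham
      let P2 : Finset ℝ := (hPfin j).toFinset.filter (fun x => a < x)
      have hP2n : P2.Nonempty := ⟨1, by simp [P2, hP1 j, ham.2.2]⟩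
      set b := P2.min' hP2n with hb
      have hbm : b ∈ P2 := P2.min'_mem hP2n
      simp only [P2, Finset.mem_filter, Set.Finite.mem_toFinset] at hbm
      have hub : u ≤ b := by
        by_contra hlt
        push Not at hlt
        have : b ∈ P1 := by
          simp only [P1, Finset.mem_filter, Set.Finite.mem_toFinset]
          exact ⟨hbm.1, hlt.le, lt_of_lt_of_le hlt hu.2⟩
        exact absurd (P1.le_max' b this) (not_le.2 hbm.2)
      have hS : ((j, a, b) : Fin s × ℝ × ℝ) ∈ S := by
        refine ⟨ham.1, hbm.1, hbm.2, ?_⟩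
        rintro x hx ⟨h1, h2⟩
        have : x ∈ P2 := by
          simp only [P2, Finset.mem_filter, Set.Finite.mem_toFinset]
          exact ⟨hx, h1⟩
        exact absurd (P2.min'_le x this) (not_le.2 h2)
      have hba : 0 < b - a := by linarith [hbm.2]
      have hv : (u - a) / (b - a) ∈ Icc (0:ℝ) 1 := by
        constructor
        · exact div_nonneg (by linarith [ham.2.1]) hba.le
        · rw [div_le_one hba]; linarith
      refine ⟨⟨(j, a, b), hS⟩, (u - a) / (b - a), hv, ?_⟩
      rw [cl_of_mem hv]
      congr 1
      simp only [w]
      field_simp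
      ring
    · rintro ⟨e, v, hv, rfl⟩
      rw [cl_of_mem hv]
      exact ⟨e.1.1, _, hwII e v hv, rfl⟩
  · intro e e' u u' hne hu hu' heq
    rw [cl_of_mem hu, cl_of_mem hu'] at heq
    by_cases hj : e.1.1 = e'.1.1
    · rw [← hj] at heq
      have hww := hinj _ (hwII e u hu) (hwII e' u' hu') heq
      by_contra hcon
      have hnP : w e u ∉ P e.1.1 := fun h => hcon (hwO e u hu h)
      have hnP' : w e' u' ∉ P e'.1.1 := by rw [← hj, ← hww]; exact hnP
      have hcon' : ¬ (u' = 0 ∨ u' = 1) := fun h => hnP' (hwE e' u' h)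
      push Not at hcon hcon'
      have h1 : 0 < u := lt_of_le_of_ne hu.1 (Ne.symm hcon.1)
      have h2 : u < 1 := lt_of_le_of_ne hu.2 hcon.2
      have h1' : 0 < u' := lt_of_le_of_ne hu'.1 (Ne.symm hcon'.1)
      have h2' : u' < 1 := lt_of_le_of_ne hu'.2 hcon'.2
      have l1 := e.2.2.2.1
      have l2 := e'.2.2.2.1
      have a1 : e.1.2.1 < w e u := by simp only [w]; nlinarith
      have a2 : w e u < e.1.2.2 := by simp only [w]; nlinarith
      have b1 : e'.1.2.1 < w e u := by rw [hww]; simp only [w]; nlinarith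
      have b2 : w e u < e'.1.2.2 := by rw [hww]; simp only [w]; nlinarith
      have m1 := e.2.2.2.2 e'.1.2.1 (hj ▸ e'.2.1)
      have m2 := e.2.2.2.2 e'.1.2.2 (hj ▸ e'.2.2.1)
      have m3 := e'.2.2.2.2 e.1.2.1 (hj ▸ e.2.1)
      have m4 := e'.2.2.2.2 e.1.2.2 (hj ▸ e.2.2.1)
      have q1 : e.1.2.1 = e'.1.2.1 := by
        rcases lt_trichotomy e.1.2.1 e'.1.2.1 with h | h | h
        · exact (m1 ⟨h, b1.trans a2⟩).elim
        · exact h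
        · exact (m3 ⟨h, a1.trans b2⟩).elim
      have q2 : e.1.2.2 = e'.1.2.2 := by
        rcases lt_trichotomy e.1.2.2 e'.1.2.2 with h | h | h
        · exact (m4 ⟨b1.trans a2, h⟩).elim
        · exact h
        · exact (m2 ⟨a1.trans b2, h⟩).elim
      exact hne (Subtype.ext (Prod.ext hj (Prod.ext q1 q2)))
    · apply hwO e u hu
      refine Or.inr (Or.inr (mem_iUnion.2 ⟨e'.1.1, fun h => hj h.symm, hwII e u hu, ?_⟩))
      rw [heq]
      exact mem_image_of_mem _ (hwII e' u' hu')
  · intro e u hu hp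
    rw [cl_of_mem hu] at hp
    apply hwO e u hu
    exact Or.inr (Or.inl ⟨hwII e u hu, hp⟩)
  · intro e u hu
    have hu' : u ∈ Icc (0:ℝ) 1 := ⟨hu.1.le, hu.2.le⟩
    have l1 := e.2.2.2.1
    have hd : 0 < e.1.2.2 - e.1.2.1 := by linarith
    have a1 : 0 < w e u := lt_of_le_of_lt (hPI _ e.2.1).1 (by simp only [w]; nlinarith [hu.1])
    have a2 : w e u < 1 := lt_of_lt_of_le (by simp only [w]; nlinarith [hu.2]) (hPI _ e.2.2.1).2
    obtain ⟨ε, hε, K, hK⟩ := hinv e.1.1 (f e.1.1 (w e u)) (mem_image_of_mem _ (hwII e u hu'))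
      (fun h => a1.ne' (hinj _ (hwII e u hu') (by simp) h))
      (fun h => a2.ne (hinj _ (hwII e u hu') (by simp) h))
    refine ⟨ε, hε, K * Real.toNNReal ((e.1.2.2 - e.1.2.1)⁻¹), ?_⟩
    intro u₁ h₁ u₂ h₂ d₁ d₂
    simp only [cl_of_mem hu', cl_of_mem h₁, cl_of_mem h₂] at d₁ d₂ ⊢
    have := hK.dist_le_mul _ ⟨mem_image_of_mem _ (hwII e u₁ h₁), d₁⟩ _
      ⟨mem_image_of_mem _ (hwII e u₂ h₂), d₂⟩
    rw [hg _ _ (hwII e u₁ h₁), hg _ _ (hwII e u₂ h₂), Real.dist_eq] at this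
    have e1 : w e u₁ - w e u₂ = (e.1.2.2 - e.1.2.1) * (u₁ - u₂) := by simp only [w]; ring
    rw [e1, abs_mul, abs_of_pos hd] at this
    push_cast
    rw [Real.coe_toNNReal _ (inv_nonneg.2 hd.le)]
    rw [show ∀ x : ℝ, (K:ℝ) * (e.1.2.2 - e.1.2.1)⁻¹ * x = (K * x) / (e.1.2.2 - e.1.2.1) by
      intro x; field_simp]
    rw [le_div_iff₀ hd]
    linarith

attribute [instance] Gr.fin Gr.dec

end UC
end

noncomputable section
namespace UC
open Set Filter Topology

lemma cont_glue {E X Y Z : Type*} [Finite E] [TopologicalSpace X] [TopologicalSpace Y]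
    [TopologicalSpace Z] [T2Space Y] (K : E → Set X) (hK : ∀ e, IsCompact (K e)) (π : E → X → Y)
    (hπ : ∀ e, ContinuousOn (π e) (K e)) (F : Y → Z)
    (hF : ∀ e, ContinuousOn (fun x => F (π e x)) (K e)) :
    ContinuousOn F (⋃ e, π e '' K e) := by
  rw [continuousOn_iff_isClosed]
  intro t ht
  have hc : ∀ e, IsCompact (π e '' (K e ∩ (fun x => F (π e x)) ⁻¹' t)) := by
    intro e
    refine IsCompact.image_of_continuousOn ?_ ((hπ e).mono inter_subset_left)
    obtain ⟨u, hu, hu'⟩ := continuousOn_iff_isClosed.1 (hF e) t ht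
    rw [inter_comm, hu', inter_comm]
    exact (hK e).inter_right hu
  refine ⟨⋃ e, π e '' (K e ∩ (fun x => F (π e x)) ⁻¹' t),
    isClosed_iUnion_of_finite (fun e => (hc e).isClosed), ?_⟩
  ext y
  simp only [mem_inter_iff, mem_iUnion, mem_image, mem_preimage]
  constructor
  · rintro ⟨h1, e, x, hx, rfl⟩
    exact ⟨⟨e, x, ⟨hx, h1⟩, rfl⟩, e, x, hx, rfl⟩
  · rintro ⟨⟨e, x, ⟨hx, h1⟩, rfl⟩, h2⟩
    exact ⟨h1, h2⟩

namespace Gr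
variable {k : ℕ} {Γ : Set (Fin k → ℂ)} {p₀ : Fin k → ℂ} (G : Gr Γ p₀)

lemma cont (e : G.E) : Continuous (G.f e) := by
  obtain ⟨K, hK⟩ := G.lip e
  exact hK.continuous

lemma mem (e : G.E) (v : ℝ) : G.f e v ∈ Γ := by
  exact (Set.ext_iff.1 G.cover _).2 (mem_iUnion.2 ⟨e, cl v, cl_mem v, (G.clamp e v).symm⟩)

lemma exists_coord {z : Fin k → ℂ} (hz : z ∈ Γ) : ∃ e, ∃ u ∈ Icc (0:ℝ) 1, G.f e u = z := by
  rw [G.cover] at hz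
  obtain ⟨e, u, hu, h⟩ := mem_iUnion.1 hz
  exact ⟨e, u, hu, h⟩

lemma uniq {e e' : G.E} {u u' : ℝ} (hu : u ∈ Ioo (0:ℝ) 1) (hu' : u' ∈ Icc (0:ℝ) 1)
    (h : G.f e u = G.f e' u') : e = e' ∧ u = u' := by
  have hI := Ioo_subset_Icc_self hu
  by_cases he : e = e'
  · subst he
    exact ⟨rfl, G.inj e hI hu' h⟩
  · rcases G.meet e e' u u' he hI hu' h with h | h
    · exact absurd h hu.1.ne'
    · exact absurd h hu.2.ne

lemma contOn {Z : Type*} [TopologicalSpace Z] (F : (Fin k → ℂ) → Z)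
    (hF : ∀ e, ContinuousOn (fun u => F (G.f e u)) (Icc 0 1)) : ContinuousOn F Γ := by
  have := cont_glue (fun _ : G.E => Icc (0:ℝ) 1) (fun _ => isCompact_Icc) G.f
    (fun e => (G.cont e).continuousOn) F hF
  rwa [← G.cover] at this

open Classical in
def pst {Z : Type*} (φ : G.E → ℝ → Z) (d : (Fin k → ℂ) → Z) (z : Fin k → ℂ) : Z :=
  if h : ∃ x : G.E × ℝ, x.2 ∈ Ioo (0:ℝ) 1 ∧ G.f x.1 x.2 = z then φ h.choose.1 h.choose.2 else d z

lemma pst_Ioo {Z : Type*} (φ : G.E → ℝ → Z) (d : (Fin k → ℂ) → Z) (e : G.E) {u : ℝ}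
    (hu : u ∈ Ioo (0:ℝ) 1) : G.pst φ d (G.f e u) = φ e u := by
  have h : ∃ x : G.E × ℝ, x.2 ∈ Ioo (0:ℝ) 1 ∧ G.f x.1 x.2 = G.f e u := ⟨(e, u), hu, rfl⟩
  rw [pst, dif_pos h]
  obtain ⟨h1, h2⟩ := G.uniq h.choose_spec.1 (Ioo_subset_Icc_self hu) h.choose_spec.2
  rw [h1, h2]

lemma pst_not {Z : Type*} (φ : G.E → ℝ → Z) (d : (Fin k → ℂ) → Z) (z : Fin k → ℂ)
    (hz : ∀ e, ∀ u ∈ Ioo (0:ℝ) 1, G.f e u ≠ z) : G.pst φ d z = d z := by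
  rw [pst, dif_neg]
  rintro ⟨x, h1, h2⟩
  exact hz _ _ h1 h2

lemma end_not {e : G.E} {u : ℝ} (hu : u = 0 ∨ u = 1) :
    ∀ e', ∀ u' ∈ Ioo (0:ℝ) 1, G.f e' u' ≠ G.f e u := by
  intro e' u' hu' h
  have hI : u ∈ Icc (0:ℝ) 1 := by rcases hu with rfl | rfl <;> simp
  obtain ⟨_, h2⟩ := G.uniq hu' hI h
  subst h2
  rcases hu with rfl | rfl
  · exact lt_irrefl _ hu'.1
  · exact lt_irrefl _ hu'.2

lemma base_not : ∀ e, ∀ u ∈ Ioo (0:ℝ) 1, G.f e u ≠ p₀ := by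
  intro e u hu h
  rcases G.base e u (Ioo_subset_Icc_self hu) h with rfl | rfl
  · exact lt_irrefl _ hu.1
  · exact lt_irrefl _ hu.2

lemma pst_Icc {Z : Type*} (φ : G.E → ℝ → Z) (d : (Fin k → ℂ) → Z)
    (h0 : ∀ e, φ e 0 = d (G.f e 0)) (h1 : ∀ e, φ e 1 = d (G.f e 1)) (e : G.E) {u : ℝ}
    (hu : u ∈ Icc (0:ℝ) 1) : G.pst φ d (G.f e u) = φ e u := by
  by_cases h : u = 0 ∨ u = 1
  · rw [G.pst_not _ _ _ (G.end_not h)]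
    rcases h with rfl | rfl
    · exact (h0 e).symm
    · exact (h1 e).symm
  · push Not at h
    exact G.pst_Ioo φ d e ⟨lt_of_le_of_ne hu.1 (Ne.symm h.1), lt_of_le_of_ne hu.2 h.2⟩

def mid (κ : ℝ) (z : Fin k → ℂ) : Prop := ∃ e, ∃ u ∈ Icc κ (1-κ), G.f e u = z

lemma mid_closed (κ : ℝ) : IsClosed {z | G.mid κ z} := by
  have : {z | G.mid κ z} = ⋃ e, G.f e '' Icc κ (1-κ) := by
    ext z; simp [mid]
  rw [this]
  exact isClosed_iUnion_of_finite (fun e => (isCompact_Icc.image (G.cont e)).isClosed)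

lemma mid_iff {κ : ℝ} (hκ : 0 < κ) {e : G.E} {u : ℝ} (hu : u ∈ Icc (0:ℝ) 1) :
    G.mid κ (G.f e u) ↔ u ∈ Icc κ (1-κ) := by
  constructor
  · rintro ⟨e', u', hu', h⟩
    obtain ⟨-, h2⟩ := G.uniq (u := u') ⟨by linarith [hu'.1], by linarith [hu'.2]⟩ hu h
    rwa [← h2]
  · intro h
    exact ⟨e, u, h, rfl⟩

lemma sep0 (e e' : G.E) (K : Set (ℝ × ℝ)) (hK : IsCompact K)
    (hne : ∀ x ∈ K, G.f e x.1 ≠ G.f e' x.2) :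
    ∃ δ > 0, ∀ x ∈ K, δ ≤ dist (G.f e x.1) (G.f e' x.2) := by
  rcases K.eq_empty_or_nonempty with rfl | hn
  · exact ⟨1, one_pos, by simp⟩
  · have hc : Continuous (fun x : ℝ × ℝ => dist (G.f e x.1) (G.f e' x.2)) :=
      ((G.cont e).comp continuous_fst).dist ((G.cont e').comp continuous_snd)
    obtain ⟨x, hx, hm⟩ := hK.exists_isMinOn hn hc.continuousOn
    exact ⟨_, dist_pos.2 (hne x hx), fun y hy => hm hy⟩

lemma sep {κ η : ℝ} (hκ : 0 < κ) (hη : 0 < η) : ∃ δ > 0, ∀ e e', ∀ u ∈ Icc κ (1-κ),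
    ∀ v ∈ Icc (0:ℝ) 1, dist (G.f e u) (G.f e' v) < δ → e = e' ∧ |u - v| < η := by
  have h1 : ∀ x : G.E × G.E, ∃ δ > 0, ∀ u ∈ Icc κ (1-κ),
    ∀ v ∈ Icc (0:ℝ) 1, dist (G.f x.1 u) (G.f x.2 v) < δ → x.1 = x.2 ∧ |u - v| < η := by
    rintro ⟨e, e'⟩
    by_cases he : e = e'
    · subst he
      obtain ⟨δ, hδ, h⟩ := G.sep0 e e ((Icc κ (1-κ) ×ˢ Icc 0 1) ∩ {x | η ≤ |x.1 - x.2|})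
        ((isCompact_Icc.prod isCompact_Icc).inter_right
          (isClosed_le continuous_const (by fun_prop))) (by
          rintro ⟨u, v⟩ ⟨⟨hu, hv⟩, hη'⟩ h
          simp only [mem_ofPred_eq] at hη' hu hv h
          have := G.inj e ⟨by linarith [hu.1], by linarith [hu.2]⟩ hv h
          rw [this] at hη'
          simp at hη'
          linarith)
      refine ⟨δ, hδ, fun u hu v hv hd => ⟨rfl, ?_⟩⟩
      by_contra hcon
      exact absurd hd (not_lt.2 (h (u, v) ⟨⟨hu, hv⟩, not_lt.1 hcon⟩))
    · obtain ⟨δ, hδ, h⟩ := G.sep0 e e' ((Icc κ (1-κ) ×ˢ Icc 0 1))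
        ((isCompact_Icc.prod isCompact_Icc)) (by
          rintro ⟨u, v⟩ ⟨hu, hv⟩ h
          exact he (G.uniq ⟨by linarith [hu.1], by linarith [hu.2]⟩ hv h).1)
      refine ⟨δ, hδ, fun u hu v hv hd => ?_⟩
      exact absurd hd (not_lt.2 (h (u, v) ⟨hu, hv⟩))
  choose δ hδ h using h1
  rcases isEmpty_or_nonempty (G.E × G.E) with hE | hE
  · exact ⟨1, one_pos, fun e e' => (hE.false (e, e')).elim⟩
  · refine ⟨Finset.univ.inf' Finset.univ_nonempty δ, ?_, ?_⟩
    · simp [Finset.lt_inf'_iff, hδ]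
    · intro e e' u hu v hv hd
      exact h (e, e') u hu v hv (hd.trans_le (Finset.inf'_le _ (Finset.mem_univ _)))

lemma sep1 {η : ℝ} (hη : 0 < η) : ∃ δ > 0, ∀ e, ∀ u ∈ Icc (0:ℝ) 1,
    ∀ v ∈ Icc (0:ℝ) 1, dist (G.f e u) (G.f e v) < δ → |u - v| < η := by
  have h1 : ∀ e : G.E, ∃ δ > 0, ∀ u ∈ Icc (0:ℝ) 1,
    ∀ v ∈ Icc (0:ℝ) 1, dist (G.f e u) (G.f e v) < δ → |u - v| < η := by
    intro e
    obtain ⟨δ, hδ, h⟩ := G.sep0 e e ((Icc 0 1 ×ˢ Icc 0 1) ∩ {x | η ≤ |x.1 - x.2|})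
        ((isCompact_Icc.prod isCompact_Icc).inter_right
          (isClosed_le continuous_const (by fun_prop))) (by
          rintro ⟨u, v⟩ ⟨⟨hu, hv⟩, hη'⟩ h
          simp only [mem_ofPred_eq] at hη' hu hv h
          have := G.inj e hu hv h
          rw [this] at hη'
          simp at hη'
          linarith)
    refine ⟨δ, hδ, fun u hu v hv hd => ?_⟩
    by_contra hcon
    exact absurd hd (not_lt.2 (h (u, v) ⟨⟨hu, hv⟩, not_lt.1 hcon⟩))
  choose δ hδ h using h1
  rcases isEmpty_or_nonempty G.E with hE | hE
  · exact ⟨1, one_pos, fun e => (hE.false e).elim⟩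
  · refine ⟨Finset.univ.inf' Finset.univ_nonempty δ, ?_, ?_⟩
    · simp [Finset.lt_inf'_iff, hδ]
    · intro e u hu v hv hd
      exact h e u hu v hv (hd.trans_le (Finset.inf'_le _ (Finset.mem_univ _)))

abbrev Lab : Type := Monoid.CoprodI (fun _ : G.E => Multiplicative ℤ)

end Gr

open Classical in
def chi (u : ℝ) : ℤ := if u < 1/2 then 0 else 1

namespace Gr
variable {k : ℕ} {Γ : Set (Fin k → ℂ)} {p₀ : Fin k → ℂ} (G : Gr Γ p₀)

def lab (e : G.E) (n : ℤ) : G.Lab :=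
  Monoid.CoprodI.of (M := fun _ : G.E => Multiplicative ℤ) (i := e) (Multiplicative.ofAdd n)

open Classical in
def tau (p q : Fin k → ℂ) : G.Lab :=
  if h : ∃ x : G.E × ℝ × ℝ, x.2.1 ∈ Ioo (0:ℝ) 1 ∧ x.2.2 ∈ Ioo (0:ℝ) 1 ∧ G.f x.1 x.2.1 = p ∧
      G.f x.1 x.2.2 = q then
    G.lab h.choose.1 (chi h.choose.2.2 - chi h.choose.2.1) else 1

lemma lab_zero (e : G.E) : G.lab e 0 = 1 := by simp [lab]
lemma lab_add (e : G.E) (m n : ℤ) : G.lab e (m + n) = G.lab e m * G.lab e n := by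
  simp [lab, ofAdd_add]

lemma tau_edge (e : G.E) {u v : ℝ} (hu : u ∈ Ioo (0:ℝ) 1) (hv : v ∈ Ioo (0:ℝ) 1) :
    G.tau (G.f e u) (G.f e v) = G.lab e (chi v - chi u) := by
  have h : ∃ x : G.E × ℝ × ℝ, x.2.1 ∈ Ioo (0:ℝ) 1 ∧ x.2.2 ∈ Ioo (0:ℝ) 1 ∧
    G.f x.1 x.2.1 = G.f e u ∧ G.f x.1 x.2.2 = G.f e v := ⟨(e, u, v), hu, hv, rfl, rfl⟩
  rw [tau, dif_pos h]
  obtain ⟨h1, h2⟩ := G.uniq h.choose_spec.1 (Ioo_subset_Icc_self hu) h.choose_spec.2.2.1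
  obtain ⟨h3, h4⟩ := G.uniq h.choose_spec.2.1 (Ioo_subset_Icc_self hv) h.choose_spec.2.2.2
  rw [h1, h2, h4]

lemma tau_not {p q : Fin k → ℂ} (h : ∀ e, ∀ u ∈ Ioo (0:ℝ) 1, ∀ v ∈ Ioo (0:ℝ) 1,
    G.f e u = p → G.f e v = q → False) : G.tau p q = 1 := by
  rw [tau, dif_neg]
  rintro ⟨x, h1, h2, h3, h4⟩
  exact h _ _ h1 _ h2 h3 h4

lemma tau_self (p : Fin k → ℂ) : G.tau p p = 1 := by
  by_cases h : ∃ e, ∃ u ∈ Ioo (0:ℝ) 1, G.f e u = p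
  · obtain ⟨e, u, hu, rfl⟩ := h
    rw [G.tau_edge e hu hu, sub_self, lab_zero]
  · push Not at h
    exact G.tau_not (fun e u hu v hv h1 h2 => h e u hu h1)

lemma tau_far : ∃ δ > 0, ∀ p q, dist p q < δ → ¬ G.mid (1/4) p → ¬ G.mid (1/4) q →
    G.tau p q = 1 := by
  obtain ⟨δ, hδ, h⟩ := G.sep1 (η := 1/4) (by norm_num)
  refine ⟨δ, hδ, fun p q hd hp hq => ?_⟩
  by_cases hc : ∃ e, ∃ u ∈ Ioo (0:ℝ) 1, ∃ v ∈ Ioo (0:ℝ) 1, G.f e u = p ∧ G.f e v = q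
  · obtain ⟨e, u, hu, v, hv, rfl, rfl⟩ := hc
    rw [G.tau_edge e hu hv]
    have hu' := Ioo_subset_Icc_self hu
    have hv' := Ioo_subset_Icc_self hv
    have h1 := h e u hu' v hv' hd
    rw [G.mid_iff (by norm_num) hu'] at hp
    rw [G.mid_iff (by norm_num) hv'] at hq
    rw [abs_lt] at h1
    simp only [mem_Icc, not_and_or, not_le] at hp hq
    have : chi u = chi v := by
      unfold chi
      rcases hp with hp | hp <;> rcases hq with hq | hq
      · rw [if_pos (by linarith), if_pos (by linarith)]
      · linarith
      · linarith
      · rw [if_neg (by linarith), if_neg (by linarith)]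
    rw [this, sub_self, lab_zero]
  · push Not at hc
    exact G.tau_not (fun e u hu v hv h1 h2 => hc e u hu v hv h1 h2)

/-- near a mid point everything lies in the same open edge -/
lemma near_mid {κ : ℝ} (hκ : 0 < κ) : ∃ δ > 0, ∀ e, ∀ u ∈ Icc κ (1-κ), ∀ q ∈ Γ,
    dist (G.f e u) q < δ → ∃ v ∈ Ioo (0:ℝ) 1, G.f e v = q := by
  obtain ⟨δ, hδ, h⟩ := G.sep hκ hκ
  refine ⟨δ, hδ, fun e u hu q hq hd => ?_⟩
  obtain ⟨e', v, hv, rfl⟩ := G.exists_coord hq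
  obtain ⟨rfl, h2⟩ := h e e' u hu v hv hd
  rw [abs_lt] at h2
  exact ⟨v, ⟨by linarith [hu.1], by linarith [hu.2]⟩, rfl⟩

lemma tau_cocycle : ∃ δ > 0, ∀ p ∈ Γ, ∀ q ∈ Γ, ∀ r ∈ Γ, dist p q < δ → dist q r < δ →
    dist p r < δ → G.tau q r * G.tau p q = G.tau p r := by
  obtain ⟨δ₁, hδ₁, h₁⟩ := G.tau_far
  obtain ⟨δ₂, hδ₂, h₂⟩ := G.near_mid (κ := 1/4) (by norm_num)
  refine ⟨min δ₁ δ₂, lt_min hδ₁ hδ₂, ?_⟩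
  intro p hp q hq r hr d1 d2 d3
  have key : ∀ e, (∃ u ∈ Ioo (0:ℝ) 1, G.f e u = p) → (∃ u ∈ Ioo (0:ℝ) 1, G.f e u = q) →
      (∃ u ∈ Ioo (0:ℝ) 1, G.f e u = r) → G.tau q r * G.tau p q = G.tau p r := by
    rintro e ⟨u, hu, rfl⟩ ⟨v, hv, rfl⟩ ⟨w, hw, rfl⟩
    rw [G.tau_edge e hu hv, G.tau_edge e hv hw, G.tau_edge e hu hw, ← lab_add]
    congr 1
    ring
  have sub : ∀ {u : ℝ}, u ∈ Icc (1/4:ℝ) (1-1/4) → u ∈ Ioo (0:ℝ) 1 := fun hu =>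
    ⟨by linarith [hu.1], by linarith [hu.2]⟩
  by_cases m1 : G.mid (1/4) p
  · obtain ⟨e, u, hu, rfl⟩ := m1
    exact key e ⟨u, sub hu, rfl⟩ (h₂ e u hu q hq (d1.trans_le (min_le_right _ _)))
      (h₂ e u hu r hr (d3.trans_le (min_le_right _ _)))
  by_cases m2 : G.mid (1/4) q
  · obtain ⟨e, u, hu, rfl⟩ := m2
    exact key e (h₂ e u hu p hp (by rw [dist_comm]; exact d1.trans_le (min_le_right _ _)))
      ⟨u, sub hu, rfl⟩ (h₂ e u hu r hr (d2.trans_le (min_le_right _ _)))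
  by_cases m3 : G.mid (1/4) r
  · obtain ⟨e, u, hu, rfl⟩ := m3
    exact key e (h₂ e u hu p hp (by rw [dist_comm]; exact d3.trans_le (min_le_right _ _)))
      (h₂ e u hu q hq (by rw [dist_comm]; exact d2.trans_le (min_le_right _ _))) ⟨u, sub hu, rfl⟩
  rw [h₁ p q (d1.trans_le (min_le_left _ _)) m1 m2, h₁ q r (d2.trans_le (min_le_left _ _)) m2 m3,
    h₁ p r (d3.trans_le (min_le_left _ _)) m1 m3, one_mul]

def word (z : ℕ → Fin k → ℂ) : ℕ → G.Lab
  | 0 => 1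
  | n + 1 => G.tau (z n) (z (n+1)) * word z n

lemma word_const (p : Fin k → ℂ) (z : ℕ → Fin k → ℂ) (n : ℕ) (h : ∀ j ≤ n, z j = p) :
    G.word z n = 1 := by
  induction n with
  | zero => rfl
  | succ n ih =>
    rw [word, ih (fun j hj => h j (by omega)), h n (by omega), h (n+1) le_rfl, tau_self, one_mul]

lemma word_congr (z z' : ℕ → Fin k → ℂ) (n : ℕ) (h : ∀ j ≤ n, z j = z' j) :
    G.word z n = G.word z' n := by
  induction n with
  | zero => rfl
  | succ n ih =>
    rw [word, word, ih (fun j hj => h j (by omega)), h n (by omega), h (n+1) le_rfl]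

lemma word_row (z z' : ℕ → Fin k → ℂ) (n : ℕ)
    (h : ∀ j < n, G.tau (z' j) (z' (j+1)) * G.tau (z j) (z' j) =
      G.tau (z (j+1)) (z' (j+1)) * G.tau (z j) (z (j+1))) :
    G.word z' n * G.tau (z 0) (z' 0) = G.tau (z n) (z' n) * G.word z n := by
  induction n with
  | zero => simp [word]
  | succ n ih =>
    rw [word, word, mul_assoc, ih (fun j hj => h j (by omega)), ← mul_assoc, h n (by omega),
      mul_assoc]

/-- null-homotopic loops have trivial words -/
lemma word_homotopy {T : ℝ} (hT : 0 < T) (A : ℝ → Fin k → ℂ) (H : ℝ × ℝ → (Fin k → ℂ))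
    (hH : ContinuousOn H (Icc 0 1 ×ˢ Icc 0 T))
    (hΓ : ∀ p ∈ Icc (0 : ℝ) 1 ×ˢ Icc (0 : ℝ) T, H p ∈ Γ)
    (h0 : ∀ x ∈ Icc (0 : ℝ) T, H (0, x) = A x)
    (h1 : ∀ x ∈ Icc (0 : ℝ) T, H (1, x) = A 0)
    (hs : ∀ s ∈ Icc (0 : ℝ) 1, H (s, 0) = A 0 ∧ H (s, T) = A 0) :
    ∃ N : ℕ, ∀ n ≥ N, G.word (fun j => A (j * (T / n))) n = 1 := by
  obtain ⟨δ, hδ, hcoc⟩ := G.tau_cocycle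
  have huc := (isCompact_Icc.prod isCompact_Icc).uniformContinuousOn_of_continuous hH
  rw [Metric.uniformContinuousOn_iff] at huc
  obtain ⟨ε, hε, huc⟩ := huc δ hδ
  obtain ⟨N, hN⟩ := exists_nat_gt (max 1 ((1 + T) / ε))
  refine ⟨N, fun n hn => ?_⟩
  have hnN : (N:ℝ) ≤ n := by exact_mod_cast hn
  have hn1 : (1:ℝ) < n := lt_of_lt_of_le (lt_of_le_of_lt (le_max_left _ _) hN) hnN
  have hn0 : (0:ℝ) < n := by linarith
  have hn2 : (1 + T) / ε < n := lt_of_lt_of_le (lt_of_le_of_lt (le_max_right _ _) hN) hnN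
  have hsm : (1 + T) / n < ε := by
    rw [div_lt_iff₀ hε] at hn2
    rw [div_lt_iff₀ hn0]; linarith
  have hs1 : 1 / (n:ℝ) < ε := lt_of_le_of_lt (by gcongr; linarith) hsm
  have hs2 : T / (n:ℝ) < ε := lt_of_le_of_lt (by gcongr; linarith) hsm
  let z : ℕ → ℕ → Fin k → ℂ := fun i j => H (i * (1 / n), j * (T / n))
  have hin : ∀ i ≤ n, ∀ j ≤ n, ((i:ℝ) * (1 / n), (j:ℝ) * (T / n)) ∈ Icc (0:ℝ) 1 ×ˢ Icc (0:ℝ) T := by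
    intro i hi j hj
    have hi' : (i:ℝ) ≤ n := by exact_mod_cast hi
    have hj' : (j:ℝ) ≤ n := by exact_mod_cast hj
    refine ⟨⟨by positivity, ?_⟩, ⟨by positivity, ?_⟩⟩
    · simp only [mul_one_div]; rw [div_le_one hn0]; exact hi'
    · simp only; rw [mul_div_assoc', div_le_iff₀ hn0, mul_comm T]; gcongr
  have hclose : ∀ i ≤ n, ∀ j ≤ n, ∀ i' ≤ n, ∀ j' ≤ n, (i' = i ∨ i' = i + 1 ∨ i = i' + 1) →
      (j' = j ∨ j' = j + 1 ∨ j = j' + 1) →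
      dist (z i j) (z i' j') < δ := by
    intro i hi j hj i' hi' j' hj' ei ej
    refine huc _ (hin i hi j hj) _ (hin i' hi' j' hj') ?_
    rw [Prod.dist_eq, max_lt_iff]
    simp only [Real.dist_eq, ← sub_mul]
    rw [abs_mul, abs_mul, abs_of_pos (show (0:ℝ) < 1 / n by positivity),
      abs_of_pos (show (0:ℝ) < T / n by positivity)]
    have b1 : |(i:ℝ) - i'| ≤ 1 := by
      rcases ei with rfl | rfl | rfl <;> simp
    have b2 : |(j:ℝ) - j'| ≤ 1 := by
      rcases ej with rfl | rfl | rfl <;> simp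
    have p1 : (0:ℝ) < 1 / n := by positivity
    have p2 : (0:ℝ) < T / n := by positivity
    constructor
    · nlinarith
    · nlinarith
  have hrow : ∀ i < n, G.word (z (i+1)) n = G.word (z i) n := by
    intro i hi
    have := G.word_row (z i) (z (i+1)) n (by
      intro j hj
      have m : ∀ i ≤ n, ∀ j ≤ n, z i j ∈ Γ := fun i hi j hj => hΓ _ (hin i hi j hj)
      rw [hcoc _ (m _ (by omega) _ (by omega)) _ (m _ (by omega) _ (by omega)) _
          (m _ (by omega) _ (by omega)), hcoc _ (m _ (by omega) _ (by omega)) _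
          (m _ (by omega) _ (by omega)) _
          (m _ (by omega) _ (by omega))] <;>
      exact hclose _ (by omega) _ (by omega) _ (by omega) _ (by omega) (by omega) (by omega))
    have e0 : ∀ i ≤ n, z i 0 = A 0 := by
      intro i hi
      have := (hs _ (hin i hi 0 (by omega)).1).1
      simpa [z] using this
    have e1 : ∀ i ≤ n, z i n = A 0 := by
      intro i hi
      have := (hs _ (hin i hi 0 (by omega)).1).2
      simp only [z]
      rwa [mul_div_cancel₀ _ hn0.ne']
    rw [e0 _ (by omega), e0 _ (by omega), e1 _ (by omega), e1 _ (by omega), tau_self, mul_one,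
      one_mul] at this
    exact this
  have hall : ∀ i ≤ n, G.word (z i) n = G.word (z 0) n := by
    intro i
    induction i with
    | zero => intro _; rfl
    | succ i ih => intro hi; rw [hrow i (by omega), ih (by omega)]
  have hlast : G.word (z n) n = 1 := by
    apply G.word_const (A 0)
    intro j hj
    have := h1 _ (hin n le_rfl j hj).2
    simp only [z]
    rwa [mul_one_div, div_self hn0.ne']
  rw [← hlast, hall n le_rfl]
  apply G.word_congr
  intro j hj
  have := h0 _ (hin 0 (by omega) j hj).2
  simp only [z]
  simp only [Nat.cast_zero, zero_mul]
  exact this.symm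

end Gr
end UC
end

noncomputable section
namespace UC
open Set Filter Topology

lemma leb {T : ℝ} (hT : 0 < T) (ε : ℝ → ℝ) (hε : ∀ t, 0 < ε t) :
    ∃ N : ℕ, 0 < N ∧ ∀ n ≥ N, ∀ j < n, ∃ t0, |(j:ℝ) * (T / n) - t0| < ε t0 ∧
      |((j + 1 : ℕ):ℝ) * (T / n) - t0| < ε t0 := by
  obtain ⟨δ, hδ, h⟩ := lebesgue_number_lemma_of_metric (s := Icc 0 T)
    (c := fun t => Metric.ball t (ε t)) isCompact_Icc (fun _ => Metric.isOpen_ball)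
    (fun t _ => mem_iUnion.2 ⟨t, Metric.mem_ball_self (hε t)⟩)
  obtain ⟨N, hN⟩ := exists_nat_gt (T / δ)
  have hN0 : 0 < N := by
    have : 0 < T / δ := by positivity
    exact_mod_cast this.trans hN
  refine ⟨N, hN0, fun n hn j hj => ?_⟩
  have hn0 : (0:ℝ) < n := by exact_mod_cast lt_of_lt_of_le hN0 hn
  have hnN : T / δ < n := lt_of_lt_of_le hN (by exact_mod_cast hn)
  have hs : T / n < δ := by
    rw [div_lt_iff₀ hδ] at hnN
    rw [div_lt_iff₀ hn0]; linarith
  have hj' : (j:ℝ) ≤ n := by exact_mod_cast hj.le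
  obtain ⟨t0, ht0⟩ := h ((j:ℝ) * (T / n)) ⟨by positivity, by
    rw [mul_div_assoc', div_le_iff₀ hn0, mul_comm T]; gcongr⟩
  refine ⟨t0, ?_, ?_⟩
  · have := ht0 (Metric.mem_ball_self hδ)
    rwa [Metric.mem_ball, Real.dist_eq] at this
  · have := @ht0 (((j + 1 : ℕ):ℝ) * (T / n)) (by
      rw [Metric.mem_ball, Real.dist_eq, ← sub_mul]
      push_cast
      rw [add_sub_cancel_left, one_mul, abs_of_pos (by positivity)]
      exact hs)
    rwa [Metric.mem_ball, Real.dist_eq] at this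

namespace Gr
variable {k : ℕ} {Γ : Set (Fin k → ℂ)} {p₀ : Fin k → ℂ} (G : Gr Γ p₀)

def rho {H : Type*} [Group H] (J : G.E → H) : G.Lab →* H :=
  Monoid.CoprodI.lift (fun e => zpowersHom H (J e))

lemma rho_lab {H : Type*} [Group H] (J : G.E → H) (e : G.E) (n : ℤ) :
    G.rho J (G.lab e n) = J e ^ n := by
  simp [rho, lab, zpowersHom_apply]

lemma word_tel {H : Type*} [Group H] (ρ : G.Lab →* H) (z : ℕ → Fin k → ℂ) (Ψ : ℕ → H) (Q : ℕ → H)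
    (g : ℕ → H) (h0 : Q 0 = 1) (hQ : ∀ j, Q (j+1) = g j * Q j) (n : ℕ)
    (hg : ∀ j < n, g j = Ψ (j+1) * ρ (G.tau (z j) (z (j+1))) * (Ψ j)⁻¹) :
    Q n = Ψ n * ρ (G.word z n) * (Ψ 0)⁻¹ := by
  induction n with
  | zero => simp [h0, word]
  | succ n ih =>
    rw [hQ, ih (fun j hj => hg j (by omega)), hg n (by omega), word, map_mul]
    group

lemma isCompact (G : Gr Γ p₀) : IsCompact Γ := by
  have := isCompact_iUnion (fun e => (isCompact_Icc (a := (0:ℝ)) (b := 1)).image (G.cont e))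
  rwa [← G.cover] at this

end Gr

structure Adm {k : ℕ} (Γ : Set (Fin k → ℂ)) (α : Fin k → ℝ → ℂ) : Prop where
  meas : ∀ i, Measurable (α i)
  bdd : ∃ C : NNReal, ∀ i t, ‖α i t‖ ≤ C
  inΓ : ∀ t, PA α t ∈ Γ

section
variable {k : ℕ} {Γ : Set (Fin k → ℂ)} {p₀ : Fin k → ℂ} {α : Fin k → ℝ → ℂ}

lemma Adm.ii (h : Adm Γ α) (i : Fin k) (s t : ℝ) : IntervalIntegrable (α i) volume s t := by
  obtain ⟨C, hC⟩ := h.bdd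
  exact ii_of_bdd (h.meas i) (hC i) s t

lemma Adm.lip (h : Adm Γ α) : ∃ K : NNReal, LipschitzWith K (PA α) := by
  obtain ⟨C, hC⟩ := h.bdd
  refine ⟨C, LipschitzWith.of_dist_le_mul fun s t => ?_⟩
  rw [dist_pi_le_iff (by positivity)]
  intro i
  rw [dist_eq_norm, Real.dist_eq]
  simp only [PA]
  rw [intervalIntegral.integral_interval_sub_left (h.ii i _ _) (h.ii i _ _)]
  exact intervalIntegral.norm_integral_le_of_norm_le_const (fun x _ => hC i x)

lemma Adm.cont (h : Adm Γ α) : Continuous (PA α) := by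
  obtain ⟨K, hK⟩ := h.lip
  exact hK.continuous

lemma Adm.nice (h : Adm Γ α) (hΓ : IsCompact Γ) {c : ℕ → Fin k → (Fin k → ℂ) → ℂ}
    (hc : ∀ p i, ContinuousOn (c p i) Γ) : Nice (bform c α) := by
  intro p
  constructor
  · refine Finset.measurable_sum _ (fun i _ => Measurable.mul ?_ (h.meas i))
    exact ((hc p i).comp_continuous h.cont h.inΓ).measurable
  · obtain ⟨C, hC⟩ := h.bdd
    have : ∀ i, ∃ D, ∀ z ∈ Γ, ‖c p i z‖ ≤ D := fun i => hΓ.exists_bound_of_continuousOn (hc p i)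
    choose D hD using this
    refine ⟨∑ i, D i * C, fun t => (norm_sum_le _ _).trans (Finset.sum_le_sum fun i _ => ?_)⟩
    rw [norm_mul]
    have := hD i _ (h.inΓ t)
    exact mul_le_mul this (hC i t) (norm_nonneg _) ((norm_nonneg _).trans this)

lemma Gr.nice (G : Gr Γ p₀) {c : ℕ → Fin k → (Fin k → ℂ) → ℂ}
    (hc : ∀ p i, ContinuousOn (c p i) Γ) (e : G.E) : Nice (pull c (G.f e)) := by
  intro p
  constructor
  · refine Finset.measurable_sum _ (fun i _ => Measurable.mul ?_ (measurable_deriv _))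
    exact ((hc p i).comp_continuous (G.cont e) (G.mem e)).measurable
  · obtain ⟨K, hK⟩ := G.lip e
    have : ∀ i, ∃ D, ∀ z ∈ Γ, ‖c p i z‖ ≤ D :=
      fun i => G.isCompact.exists_bound_of_continuousOn (hc p i)
    choose D hD using this
    refine ⟨∑ i, D i * K, fun t => (norm_sum_le _ _).trans (Finset.sum_le_sum fun i _ => ?_)⟩
    rw [norm_mul]
    have := hD i _ (G.mem e t)
    exact mul_le_mul this (lip_bound (lip_comp hK i) t) (norm_nonneg _) ((norm_nonneg _).trans this)

structure Form (G : Gr Γ p₀) (κ : ℝ) where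
  c : ℕ → Fin k → (Fin k → ℂ) → ℂ
  cont : ∀ p i, ContinuousOn (c p i) Γ
  supp : ∀ p i, ∀ z ∈ Γ, ¬ G.mid κ z → c p i z = 0

variable {G : Gr Γ p₀} {κ : ℝ}

def Form.J (h : Form G κ) (e : G.E) : Equiv.Perm (ℕ → ℂ) := Tr (G.nice h.cont e) 0 1

def Form.Psi (h : Form G κ) (z : Fin k → ℂ) : Equiv.Perm (ℕ → ℂ) :=
  G.pst (fun e u => Tr (G.nice h.cont e) (chi u) u) (fun _ => 1) z

lemma Form.Psi_one (h : Form G κ) (hκ : 0 < κ) (hκ' : κ ≤ 1/4) {z : Fin k → ℂ}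
    (hz : ¬ G.mid κ z) : h.Psi z = 1 := by
  by_cases hc : ∃ e, ∃ u ∈ Ioo (0:ℝ) 1, G.f e u = z
  · obtain ⟨e, u, hu, rfl⟩ := hc
    rw [Form.Psi, G.pst_Ioo _ _ _ hu]
    rw [G.mid_iff hκ (Ioo_subset_Icc_self hu)] at hz
    simp only [mem_Icc, not_and_or, not_le] at hz
    apply Tr_eq_one
    intro p r hr
    have hr' : r ∈ Icc (0:ℝ) 1 ∧ ¬ r ∈ Icc κ (1-κ) := by
      simp only [mem_Icc, not_and_or, not_le]
      rcases hz with hz | hz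
      · rw [chi, if_pos (by linarith)] at hr
        simp only [Int.cast_zero] at hr
        rw [uIcc_of_le hu.1.le] at hr
        exact ⟨⟨hr.1, by linarith [hr.2, hu.2]⟩, Or.inl (by linarith [hr.2])⟩
      · rw [chi, if_neg (by linarith)] at hr
        simp only [Int.cast_one] at hr
        rw [uIcc_of_ge hu.2.le] at hr
        exact ⟨⟨by linarith [hr.1, hu.1], hr.2⟩, Or.inr (by linarith [hr.1])⟩
    refine Finset.sum_eq_zero fun i _ => ?_
    rw [h.supp p i _ (G.mem e r), zero_mul]
    rw [G.mid_iff hκ hr'.1]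
    exact hr'.2
  · push Not at hc
    rw [Form.Psi, G.pst_not _ _ _ hc]

lemma Form.edge_formula (h : Form G κ) (e : G.E) (u v : ℝ) :
    Tr (G.nice h.cont e) u v = Tr (G.nice h.cont e) (chi v) v * h.J e ^ (chi v - chi u) *
      (Tr (G.nice h.cont e) (chi u) u)⁻¹ := by
  have h01 : ∀ a b : ℤ, (a = 0 ∨ a = 1) → (b = 0 ∨ b = 1) →
      h.J e ^ (b - a) = Tr (G.nice h.cont e) a b := by
    rintro a b (rfl | rfl) (rfl | rfl)
    · simp [Tr_self]
    · simp [Form.J]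
    · simp [Form.J, Tr_inv]
    · simp [Tr_self]
  have hchi : ∀ u, chi u = 0 ∨ chi u = 1 := by
    intro u; unfold chi; split_ifs <;> simp
  rw [h01 _ _ (hchi u) (hchi v), Tr_inv, Tr_mul, Tr_mul]

lemma holo_local (G : Gr Γ p₀) (hA : Adm Γ α) (hκ : 0 < κ) (hκ' : κ ≤ 1/4) (t0 : ℝ) :
    ∃ ε > 0, ∀ h : Form G κ, ∀ s t, |s - t0| < ε → |t - t0| < ε →
      Tr (hA.nice G.isCompact h.cont) s t =
        h.Psi (PA α t) * G.rho h.J (G.tau (PA α s) (PA α t)) * (h.Psi (PA α s))⁻¹ := by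
  have hcont := hA.cont
  by_cases hm : G.mid κ (PA α t0)
  · obtain ⟨e, u0, hu0, hAe⟩ := hm
    obtain ⟨δ, hδ, hnear⟩ := G.near_mid hκ
    have hu0' : u0 ∈ Ioo (0:ℝ) 1 := ⟨by linarith [hu0.1], by linarith [hu0.2]⟩
    obtain ⟨ε₁, hε₁, K, hK⟩ := G.inv e u0 hu0'
    obtain ⟨ε, hε, hb⟩ := Metric.continuous_iff.1 hcont t0 (min δ ε₁) (lt_min hδ hε₁)
    simp only [Real.dist_eq] at hb
    have hu : ∀ t, ∃ v, |t - t0| < ε → v ∈ Ioo (0:ℝ) 1 ∧ G.f e v = PA α t := by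
      intro t
      by_cases ht : |t - t0| < ε
      · obtain ⟨v, hv, hv'⟩ := hnear e u0 hu0 (PA α t) (hA.inΓ t) (by
          rw [hAe, dist_comm]; exact (hb t ht).trans_le (min_le_left _ _))
        exact ⟨v, fun _ => ⟨hv, hv'⟩⟩
      · exact ⟨0, fun h => absurd h ht⟩
    choose u hu using hu
    obtain ⟨KA, hKA⟩ := hA.lip
    have hlip : LipschitzOnWith (K * KA) u (Metric.ball t0 ε) := by
      apply LipschitzOnWith.of_dist_le_mul
      intro s hs t ht
      rw [Metric.mem_ball, Real.dist_eq] at hs ht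
      have h1 := hK (u s) (Ioo_subset_Icc_self (hu s hs).1) (u t) (Ioo_subset_Icc_self (hu t ht).1)
        (by rw [(hu s hs).2, hAe]; exact (hb s hs).trans_le (min_le_right _ _))
        (by rw [(hu t ht).2, hAe]; exact (hb t ht).trans_le (min_le_right _ _))
      rw [(hu s hs).2, (hu t ht).2] at h1
      rw [Real.dist_eq]
      refine h1.trans ?_
      push_cast
      rw [mul_assoc]
      gcongr
      exact hKA.dist_le_mul s t
    refine ⟨ε, hε, fun h s t hs ht => ?_⟩
    obtain ⟨Kf, hKf⟩ := G.lip e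
    rw [transfer (hα := hA.ii) hKf (fun p i => (h.cont p i).comp_continuous (G.cont e) (G.mem e))
      (G.nice h.cont e) (hA.nice G.isCompact h.cont) Metric.isOpen_ball
      (convex_ball t0 ε).ordConnected hlip (fun r hr => ((hu r hr).2).symm)
      (s := s) (t := t) hs ht]
    rw [← (hu s hs).2, ← (hu t ht).2, G.tau_edge e (hu s hs).1 (hu t ht).1, G.rho_lab, Form.Psi,
      Form.Psi, G.pst_Ioo _ _ _ (hu s hs).1, G.pst_Ioo _ _ _ (hu t ht).1]
    exact h.edge_formula e _ _
  · obtain ⟨δ, hδ, hfar⟩ := G.tau_far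
    have ho : ∀ᶠ t in 𝓝 t0, ¬ G.mid κ (PA α t) := by
      have := (G.mid_closed κ).isOpen_compl.preimage hcont
      exact this.mem_nhds hm
    obtain ⟨ε₁, hε₁, h1⟩ := Metric.eventually_nhds_iff.1 ho
    obtain ⟨ε₂, hε₂, h2⟩ := Metric.continuous_iff.1 hcont t0 (δ/2) (by positivity)
    refine ⟨min ε₁ ε₂, lt_min hε₁ hε₂, fun h s t hs ht => ?_⟩
    have hms : ¬ G.mid κ (PA α s) := h1 (by rw [Real.dist_eq]; exact hs.trans_le (min_le_left _ _))
    have hmt : ¬ G.mid κ (PA α t) := h1 (by rw [Real.dist_eq]; exact ht.trans_le (min_le_left _ _))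
    have mono : ∀ z, ¬ G.mid κ z → ¬ G.mid (1/4) z := by
      rintro z hz ⟨e, u, hu, rfl⟩
      exact hz ⟨e, u, ⟨by linarith [hu.1], by linarith [hu.2]⟩, rfl⟩
    rw [hfar _ _ ?_ (mono _ hms) (mono _ hmt), h.Psi_one hκ hκ' hms, h.Psi_one hκ hκ' hmt]
    · simp only [map_one, mul_one, inv_one]
      apply Tr_eq_one
      intro p r hr
      have hr' : |r - t0| < min ε₁ ε₂ := by
        have := (convex_ball t0 (min ε₁ ε₂)).ordConnected.uIcc_subset (x := s) (y := t) hs ht hr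
        exact this
      refine Finset.sum_eq_zero fun i _ => ?_
      rw [h.supp p i _ (hA.inΓ r) (h1 (by rw [Real.dist_eq]; exact hr'.trans_le (min_le_left _ _))),
        zero_mul]
    · have a1 := h2 s (by rw [Real.dist_eq]; exact hs.trans_le (min_le_right _ _))
      have a2 := h2 t (by rw [Real.dist_eq]; exact ht.trans_le (min_le_right _ _))
      linarith [dist_triangle_right (PA α s) (PA α t) (PA α t0)]

lemma holo (G : Gr Γ p₀) (hA : Adm Γ α) (hκ : 0 < κ) (hκ' : κ ≤ 1/4) {T : ℝ} (hT : 0 < T)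
    (h0 : PA α 0 = p₀) (h1 : PA α T = p₀) :
    ∃ N : ℕ, ∀ n ≥ N, ∀ h : Form G κ,
      Tr (hA.nice G.isCompact h.cont) 0 T =
        G.rho h.J (G.word (fun j => PA α (j * (T / n))) n) := by
  choose ε hε hloc using holo_local (κ := κ) G hA hκ hκ'
  obtain ⟨N, hN0, hN⟩ := leb hT ε hε
  refine ⟨N, fun n hn h => ?_⟩
  have hn0 : (n:ℝ) ≠ 0 := by
    have : 0 < n := lt_of_lt_of_le hN0 hn
    exact_mod_cast this.ne'
  have := G.word_tel (G.rho h.J) (fun j => PA α (j * (T / n))) (fun j => h.Psi (PA α (j * (T / n))))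
    (fun j => Tr (hA.nice G.isCompact h.cont) 0 (j * (T / n)))
    (fun j => Tr (hA.nice G.isCompact h.cont) (j * (T / n)) ((j+1 : ℕ) * (T / n)))
    (by simp [Tr_self]) (fun j => by rw [Tr_mul]) n (by
      intro j hj
      obtain ⟨t0, ht1, ht2⟩ := hN n hn j hj
      exact hloc t0 h _ _ ht1 ht2)
  simp only [Nat.cast_zero, zero_mul] at this
  rw [mul_div_cancel₀ _ hn0] at this
  rw [this, h0, h1]
  have hp : h.Psi p₀ = 1 := by
    rw [Form.Psi, G.pst_not _ _ _ G.base_not]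
  rw [hp]; simp
end
end UC
end

noncomputable section
namespace UC
open Set Filter Topology
variable {k : ℕ} {Γ : Set (Fin k → ℂ)} {p₀ : Fin k → ℂ} {α : Fin k → ℝ → ℂ}

lemma ae_zero_level {g : ℝ → ℂ} (hg : ∀ s t, IntervalIntegrable g volume s t) (c : ℂ) :
    ∀ᵐ t, (∫ r in (0:ℝ)..t, g r) = c → g t = 0 := by
  set S : Set ℝ := {t | (∫ r in (0:ℝ)..t, g r) = c} with hS
  have hc : {x ∈ S | 𝓝[S ∩ Ioi x] x = ⊥}.Countable := countable_setOfPred_isolated_right_within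
  filter_upwards [_root_.LocallyIntegrable.ae_hasDerivAt_integral (loc_int hg), hc.ae_notMem volume]
    with t ht hn htS
  have hne : (𝓝[S ∩ Ioi t] t).NeBot := ⟨fun h => hn ⟨htS, h⟩⟩
  have h1 := (ht 0).tendsto_slope
  have h2 : Tendsto (slope (fun x => ∫ r in (0:ℝ)..x, g r) t) (𝓝[S ∩ Ioi t] t) (𝓝 (g t)) :=
    h1.mono_left (nhdsWithin_mono _ (fun x hx => ne_of_gt hx.2))
  have h3 : Tendsto (slope (fun x => ∫ r in (0:ℝ)..x, g r) t) (𝓝[S ∩ Ioi t] t) (𝓝 0) := by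
    refine tendsto_const_nhds.congr' ?_
    filter_upwards [self_mem_nhdsWithin] with x hx
    have e1 : (∫ r in (0:ℝ)..x, g r) = c := hx.1
    rw [slope_def_module, e1, htS]; simp
  exact tendsto_nhds_unique h2 h3

def cut (n : ℕ) (u : ℝ) : ℝ := cl ((n + 4) * min u (1 - u) - 1)

def Gr.cutoff (G : Gr Γ p₀) (n : ℕ) (z : Fin k → ℂ) : ℂ :=
  G.pst (fun _ u => (cut n u : ℂ)) (fun _ => 0) z

lemma cut_zero {n : ℕ} {u : ℝ} (hu : ¬ u ∈ Icc (1 / ((n:ℝ) + 4)) (1 - 1 / ((n:ℝ) + 4))) :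
    cut n u = 0 := by
  have hn : (0:ℝ) < n + 4 := by positivity
  unfold cut cl
  apply max_eq_left
  refine (min_le_right _ _).trans ?_
  simp only [mem_Icc, not_and_or, not_le] at hu
  have : min u (1-u) ≤ 1 / ((n:ℝ) + 4) := by
    rcases hu with h | h
    · exact (min_le_left _ _).trans h.le
    · exact (min_le_right _ _).trans (by linarith)
  have h2 : ((n:ℝ)+4) * min u (1-u) ≤ (n+4) * (1 / ((n:ℝ) + 4)) := by gcongr
  rw [mul_one_div, div_self hn.ne'] at h2
  linarith

lemma Gr.cutoff_Icc (G : Gr Γ p₀) (n : ℕ) (e : G.E) {u : ℝ} (hu : u ∈ Icc (0:ℝ) 1) :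
    G.cutoff n (G.f e u) = cut n u := by
  have hn : (0:ℝ) < 1 / (n + 4) := by positivity
  refine G.pst_Icc _ _ (fun e => ?_) (fun e => ?_) e hu
  · rw [cut_zero]; · simp
    simp only [mem_Icc, not_and_or, not_le]; left; exact hn
  · rw [cut_zero]; · simp
    simp only [mem_Icc, not_and_or, not_le]; right; linarith

def Gr.cutForm (G : Gr Γ p₀) (l : ℕ → Fin k) (n : ℕ) : Form G (1 / (n + 4)) where
  c p i z := if i = l p then G.cutoff n z else 0
  cont p i := by
    split_ifs
    · apply G.contOn
      intro e
      have : Continuous (fun u => (cut n u : ℂ)) := by unfold cut cl; fun_prop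
      exact this.continuousOn.congr (fun u hu => G.cutoff_Icc n e hu)
    · exact continuousOn_const
  supp p i z hz hm := by
    split_ifs
    · obtain ⟨e, u, hu, rfl⟩ := G.exists_coord hz
      rw [G.cutoff_Icc n e hu, cut_zero]; · simp
      rwa [G.mid_iff (by positivity) hu] at hm
    · rfl

lemma cutForm_bform (G : Gr Γ p₀) (l : ℕ → Fin k) (n p : ℕ) (t : ℝ) :
    bform (G.cutForm l n).c α p t = G.cutoff n (PA α t) * α (l p) t := by
  simp [bform, Gr.cutForm]

lemma word_one_imp (G : Gr Γ p₀) (hA : Adm Γ α) {T : ℝ} (hT : 0 < T)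
    (h0 : PA α 0 = p₀) (h1 : PA α T = p₀)
    (hw : ∃ N : ℕ, ∀ n ≥ N, G.word (fun j => PA α (j * (T / n))) n = 1) (l : ℕ → Fin k)
    (x : ℕ → ℂ) (p : ℕ) : sol (fun p => α (l p)) 0 x p T = x p := by
  obtain ⟨C, hC⟩ := hA.bdd
  have hlim := sol_tendsto (βn := fun n => bform (G.cutForm l n).c α) (β := fun p => α (l p))
    (fun n => hA.nice G.isCompact (G.cutForm l n).cont) (fun _ => C) ?_ ?_ 0 x p T
  · refine tendsto_nhds_unique hlim (tendsto_const_nhds.congr fun m => ?_)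
    obtain ⟨N₁, hN₁⟩ := hw
    obtain ⟨N₂, hN₂⟩ := holo (κ := 1 / ((m:ℝ) + 4)) G hA (by positivity)
      (by apply one_div_le_one_div_of_le <;> linarith [(Nat.cast_nonneg m : (0:ℝ) ≤ m)]) hT h0 h1
    have := hN₂ (max N₁ N₂) (le_max_right _ _) (G.cutForm l m)
    rw [hN₁ _ (le_max_left _ _), map_one] at this
    have h3 := congrFun (DFunLike.congr_fun this x) p
    rw [Tr_apply] at h3
    exact h3.symm
  · intro n p t
    rw [cutForm_bform, norm_mul]
    obtain ⟨e, u, hu, h⟩ := G.exists_coord (hA.inΓ t)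
    rw [← h, G.cutoff_Icc n e hu]
    have h2 := cl_mem ((n + 4) * min u (1 - u) - 1)
    have : ‖((cut n u : ℝ) : ℂ)‖ ≤ 1 := by
      rw [Complex.norm_real, cut, Real.norm_of_nonneg h2.1]; exact h2.2
    calc _ ≤ 1 * (C:ℝ) := mul_le_mul this (hC _ _) (norm_nonneg _) zero_le_one
      _ = C := one_mul _
  · intro p
    have hz : ∀ᵐ t, ∀ e : G.E, (PA α t = G.f e 0 → α (l p) t = 0) ∧
        (PA α t = G.f e 1 → α (l p) t = 0) := by
      rw [ae_all_iff]
      intro e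
      filter_upwards [ae_zero_level (hA.ii (l p)) (G.f e 0 (l p)),
        ae_zero_level (hA.ii (l p)) (G.f e 1 (l p))] with t a1 a2
      exact ⟨fun h => a1 (congrFun h (l p)), fun h => a2 (congrFun h (l p))⟩
    filter_upwards [hz] with t ht
    simp only [cutForm_bform]
    obtain ⟨e, u, hu, h⟩ := G.exists_coord (hA.inΓ t)
    by_cases hv : u = 0 ∨ u = 1
    · have : α (l p) t = 0 := by
        rcases hv with rfl | rfl
        · exact (ht e).1 h.symm
        · exact (ht e).2 h.symm
      simp [this]
    · push Not at hv
      have hu0 : 0 < min u (1-u) := lt_min (lt_of_le_of_ne hu.1 (Ne.symm hv.1))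
        (by have := lt_of_le_of_ne hu.2 hv.2; linarith)
      refine tendsto_const_nhds.congr' ?_
      obtain ⟨M, hM⟩ := exists_nat_gt (2 / min u (1-u))
      filter_upwards [eventually_ge_atTop M] with n hn
      have hn' : (M:ℝ) ≤ n := by exact_mod_cast hn
      rw [← h, G.cutoff_Icc n e hu, cut, cl, min_eq_left, max_eq_right zero_le_one]
      · simp
      · rw [div_lt_iff₀ hu0] at hM
        nlinarith
end UC
end

noncomputable section
namespace UC
open Set Filter Topology

lemma int_inv (R : ℝ) : IntegrableOn (fun ζ : ℂ => ζ⁻¹) (Metric.ball 0 R) := by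
  have h := (integrableOn_fun_norm_addHaar (E := ℂ) (volume : Measure ℂ) (f := fun y : ℝ => y⁻¹) (r := R)).2 (by
    rw [Complex.finrank_real_complex]
    have : IntegrableOn (fun _ : ℝ => (1:ℝ)) (Ioo 0 R) := by
      rw [integrableOn_const_iff]; right; simp
    refine this.congr_fun (fun x hx => ?_) measurableSet_Ioo
    simp [hx.1.ne'])
  refine h.mono' (by fun_prop) ?_
  filter_upwards with ζ
  simp

lemma int_inv' (w : ℂ) (R : ℝ) : IntegrableOn (fun ζ : ℂ => (ζ - w)⁻¹) (Metric.ball w R) := by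
  have h := (int_inv R)
  have hp := (measurePreserving_sub_right (volume : Measure ℂ) w)
  have := (hp.integrableOn_comp_preimage (Homeomorph.subRight w).measurableEmbedding
    (s := Metric.ball 0 R) (f := fun ζ : ℂ => ζ⁻¹)).2 h
  have hpre : (fun x => x - w) ⁻¹' Metric.ball 0 R = Metric.ball w R := by
    ext z; simp [dist_eq_norm]
  rw [hpre] at this
  exact this

lemma int_inv'' (w : ℂ) (R : ℝ) : IntegrableOn (fun ζ : ℂ => (ζ - w)⁻¹) (Metric.ball 0 R) :=
  (int_inv' w (R + ‖w‖)).mono_set (Metric.ball_subset_ball' (by simp))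

lemma inner_int {w : ℂ} {r : ℝ} (hr : 0 < r) :
    ∫ θ in Ioo (-Real.pi) Real.pi, (circleMap 0 r θ - w)⁻¹ =
      2 * Real.pi * Real.circleAverage (fun z => (z - w)⁻¹) 0 r := by
  rw [Real.circleAverage_eq_integral_add (-Real.pi), ← integral_Ioc_eq_integral_Ioo,
    ← intervalIntegral.integral_of_le (by linarith [Real.pi_pos])]
  rw [intervalIntegral.integral_comp_add_right (fun θ => (circleMap 0 r θ - w)⁻¹)]
  rw [Complex.real_smul]
  push_cast
  rw [← mul_assoc, mul_inv_cancel₀ (by simp [Real.pi_ne_zero]), one_mul]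
  congr 1 <;> ring

lemma avg_big {w : ℂ} {r : ℝ} (hr : ‖w‖ < r) :
    Real.circleAverage (fun z => (z - w)⁻¹) 0 r = 0 := by
  have hr0 : 0 < r := lt_of_le_of_lt (norm_nonneg _) hr
  by_cases hw : w = 0
  · subst hw
    rw [Real.circleAverage_eq_circleIntegral hr0.ne']
    have : (fun z : ℂ => (z - 0)⁻¹ • (z - 0)⁻¹) = fun z => (z - 0) ^ (-2 : ℤ) := by
      ext z; simp [zpow_neg, pow_two]
    rw [this, circleIntegral.integral_sub_zpow_of_ne (by norm_num)]
    simp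
  · have h1 := DiffContOnCl.circleAverage_smul_div (c := 0) (R := r) (w := w)
      (f := fun _ => (1:ℂ)) diffContOnCl_const (by simpa [abs_of_pos hr0] using hr)
    have h2 : Set.EqOn (fun z => (z - w)⁻¹) (fun z : ℂ => w⁻¹ • (((z - 0) / (z - w)) • (1:ℂ) - 1))
        (Metric.sphere 0 |r|) := by
      intro z hz
      have hzn : ‖z‖ = r := by simpa [abs_of_pos hr0] using hz
      have : z - w ≠ 0 := by
        intro h; rw [sub_eq_zero] at h; subst h; linarith
      simp only [smul_eq_mul]
      field_simp
      ring
    rw [Real.circleAverage_congr_sphere h2, Real.circleAverage_fun_smul, Real.circleAverage_fun_sub, h1,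
      Real.circleAverage_const]
    · simp
    · apply ContinuousOn.circleIntegrable'
      intro z hz
      have hzn : ‖z‖ = r := by simpa [abs_of_pos hr0] using hz
      have : z - w ≠ 0 := by
        intro h; rw [sub_eq_zero] at h; subst h; linarith
      apply ContinuousAt.continuousWithinAt
      fun_prop (disch := assumption)
    · exact circleIntegrable_const _ _ _

lemma avg_small {w : ℂ} {r : ℝ} (hr0 : 0 < r) (hr : r < ‖w‖) :
    Real.circleAverage (fun z => (z - w)⁻¹) 0 r = - w⁻¹ := by
  have h1 := DiffContOnCl.circleAverage (c := 0) (R := r) (f := fun z => (z - w)⁻¹) (by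
    rw [abs_of_pos hr0]
    apply DifferentiableOn.diffContOnCl
    intro z hz
    rw [closure_ball _ hr0.ne'] at hz
    have hzn : ‖z‖ ≤ r := by simpa using hz
    have : z - w ≠ 0 := by
      intro h; rw [sub_eq_zero] at h; subst h; linarith
    apply DifferentiableAt.differentiableWithinAt
    fun_prop (disch := assumption))
  rw [h1]; simp

lemma cauchyT {w : ℂ} {R : ℝ} (hw : ‖w‖ < R) :
    ∫ ζ in Metric.ball (0:ℂ) R, (ζ - w)⁻¹ = - Real.pi * (starRingEnd ℂ) w := by
  have hR : 0 < R := lt_of_le_of_lt (norm_nonneg _) hw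
  set F : ℂ → ℂ := (Metric.ball (0:ℂ) R).indicator (fun ζ => (ζ - w)⁻¹) with hF
  have hFm : Measurable F := by
    apply Measurable.indicator (by fun_prop) measurableSet_ball
  have hFi : Integrable F := by
    rw [hF, integrable_indicator_iff measurableSet_ball]; exact int_inv'' w R
  rw [← integral_indicator measurableSet_ball, ← Complex.integral_comp_polarCoord_symm]
  have hcirc : ∀ p : ℝ × ℝ, Complex.polarCoord.symm p = circleMap 0 p.1 p.2 := by
    intro p
    rw [Complex.polarCoord_symm_apply, circleMap, zero_add, Complex.exp_mul_I]
    push_cast; rfl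
  have htar : polarCoord.target = Ioi (0:ℝ) ×ˢ Ioo (-Real.pi) Real.pi := rfl
  have hm : Measurable (fun p : ℝ × ℝ => p.1 • F (circleMap 0 p.1 p.2)) := by
    apply Measurable.smul measurable_fst
    apply hFm.comp
    unfold circleMap; fun_prop
  have hint : IntegrableOn (fun p : ℝ × ℝ => p.1 • F (circleMap 0 p.1 p.2))
      (Ioi (0:ℝ) ×ˢ Ioo (-Real.pi) Real.pi) := by
    refine ⟨hm.aestronglyMeasurable, ?_⟩
    have := Complex.lintegral_comp_polarCoord_symm (fun ζ => ‖F ζ‖ₑ)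
    rw [hasFiniteIntegral_iff_enorm]
    have h2 := hFi.2
    rw [hasFiniteIntegral_iff_enorm, ← this, htar] at h2
    refine lt_of_le_of_lt (le_of_eq ?_) h2
    refine setLIntegral_congr_fun (measurableSet_Ioi.prod measurableSet_Ioo) (fun p hp => ?_)
    rw [hcirc, enorm_smul, smul_eq_mul, Real.enorm_of_nonneg (le_of_lt hp.1)]
  simp only [hcirc]
  rw [htar, Measure.volume_eq_prod, setIntegral_prod _ (by rw [← Measure.volume_eq_prod]; exact hint)]
  have hin : ∀ r ∈ Ioi (0:ℝ), r ≠ ‖w‖ →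
      ∫ θ in Ioo (-Real.pi) Real.pi, r • F (circleMap 0 r θ) =
      (Ioo 0 ‖w‖).indicator (fun r : ℝ => (r:ℂ) * (2 * Real.pi * (- w⁻¹))) r := by
    intro r hr hrw
    have hr0 : 0 < r := hr
    rw [integral_smul]
    by_cases hrR : r < R
    · have : ∀ θ, F (circleMap 0 r θ) = (circleMap 0 r θ - w)⁻¹ := by
        intro θ
        rw [hF, indicator_of_mem]
        simp [abs_of_pos hr0, hrR]
      simp only [this]
      rw [inner_int hr0]
      by_cases hlt : r < ‖w‖
      · rw [indicator_of_mem (show r ∈ Ioo 0 ‖w‖ from ⟨hr0, hlt⟩), avg_small hr0 hlt]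
        rw [Complex.real_smul]
      · rw [indicator_of_notMem (fun h => hlt h.2), avg_big (lt_of_le_of_ne (not_lt.1 hlt) hrw.symm)]
        simp
    · have : ∀ θ, F (circleMap 0 r θ) = 0 := by
        intro θ
        rw [hF, indicator_of_notMem]
        simp [abs_of_pos hr0]; linarith
      simp only [this]
      rw [indicator_of_notMem (fun h => hrR (h.2.trans hw))]
      simp
  have hae : ∀ᵐ r : ℝ, r ∈ Ioi (0:ℝ) → ∫ θ in Ioo (-Real.pi) Real.pi, r • F (circleMap 0 r θ) =
      (Ioo 0 ‖w‖).indicator (fun r : ℝ => (r:ℂ) * (2 * Real.pi * (- w⁻¹))) r := by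
    have : ∀ᵐ r : ℝ, r ≠ ‖w‖ := by simp [ae_iff, measure_singleton]
    filter_upwards [this] with r hr hr0 using hin r hr0 hr
  rw [setIntegral_congr_ae measurableSet_Ioi hae, setIntegral_indicator measurableSet_Ioo,
    inter_eq_self_of_subset_right Ioo_subset_Ioi_self, ← integral_Ioc_eq_integral_Ioo,
    ← intervalIntegral.integral_of_le (norm_nonneg _), intervalIntegral.integral_mul_const,
    intervalIntegral.integral_ofReal, integral_id]
  by_cases hw0 : w = 0
  · simp [hw0]
  · have := Complex.mul_conj w
    rw [Complex.normSq_eq_norm_sq] at this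
    push_cast at this ⊢
    rw [zero_pow two_ne_zero, sub_zero, ← this]
    field_simp

/-- small sets have uniformly small Cauchy potentials -/
lemma small_pot {ε : ℝ} (hε : 0 < ε) : ∃ δ > (0:ℝ), ∀ U : Set ℂ, MeasurableSet U →
    volume U ≤ ENNReal.ofReal δ → ∀ w : ℂ,
    ‖∫ ζ in U, (ζ - w)⁻¹‖ ≤ ε := by
  have h0 : Tendsto (fun n : ℕ => ∫ ζ in Metric.ball (0:ℂ) (1 / (n + 1)), ‖ζ‖⁻¹) atTop (𝓝 0) := by
    have h1 : IntegrableOn (fun ζ : ℂ => ‖ζ‖⁻¹) (Metric.ball 0 1) := by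
      have := (int_inv 1).norm
      simp only [norm_inv] at this
      exact this
    have := tendsto_setIntegral_of_antitone (μ := volume) (f := fun ζ : ℂ => ‖ζ‖⁻¹)
      (s := fun n : ℕ => Metric.ball (0:ℂ) (1 / (n + 1))) (fun n => measurableSet_ball)
      (fun m n h => Metric.ball_subset_ball (by gcongr)) ⟨0, by simpa using h1⟩
    have he : (⋂ n : ℕ, Metric.ball (0:ℂ) (1 / (n + 1))) ⊆ {0} := by
      intro z hz
      rw [mem_iInter] at hz
      rw [mem_singleton_iff]
      by_contra hne
      obtain ⟨n, hn⟩ := exists_nat_one_div_lt (norm_pos_iff.2 hne)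
      have := hz n
      rw [mem_ball_zero_iff] at this
      linarith
    rwa [setIntegral_measure_zero _ (measure_mono_null he (measure_singleton _))] at this
  obtain ⟨n, hn⟩ := (h0.eventually (gt_mem_nhds (half_pos hε))).exists
  set r : ℝ := 1 / (n + 1) with hr
  have hr0 : 0 < r := by positivity
  refine ⟨ε / 2 * r, by positivity, fun U hU hv w => ?_⟩
  have hvfin : volume U ≠ ⊤ := ne_top_of_le_ne_top ENNReal.ofReal_ne_top hv
  -- split
  have hI1 : IntegrableOn (fun ζ : ℂ => ‖(ζ - w)⁻¹‖) (Metric.ball w r) := (int_inv' w r).norm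
  have hmaj : ∀ ζ ∈ U, ‖(ζ - w)⁻¹‖ ≤
      (Metric.ball w r).indicator (fun ζ => ‖(ζ - w)⁻¹‖) ζ + r⁻¹ := by
    intro ζ _
    by_cases h : ζ ∈ Metric.ball w r
    · rw [indicator_of_mem h]; linarith [inv_pos.2 hr0]
    · rw [indicator_of_notMem h, zero_add, norm_inv]
      rw [Metric.mem_ball, dist_eq_norm, not_lt] at h
      exact inv_anti₀ hr0 h
  have hI2 : Integrable ((Metric.ball w r).indicator (fun ζ : ℂ => ‖(ζ - w)⁻¹‖)) :=
    (integrable_indicator_iff measurableSet_ball).2 hI1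
  have hI3 : IntegrableOn (fun ζ : ℂ => (Metric.ball w r).indicator (fun ζ => ‖(ζ - w)⁻¹‖) ζ + r⁻¹) U :=
    hI2.integrableOn.add (by rw [integrableOn_const_iff]; right; exact hvfin.lt_top)
  calc ‖∫ ζ in U, (ζ - w)⁻¹‖ ≤ ∫ ζ in U, ‖(ζ - w)⁻¹‖ := norm_integral_le_integral_norm _
    _ ≤ ∫ ζ in U, ((Metric.ball w r).indicator (fun ζ => ‖(ζ - w)⁻¹‖) ζ + r⁻¹) := by
        refine setIntegral_mono_on ?_ hI3 hU hmaj
        refine hI3.mono' (by fun_prop) ?_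
        filter_upwards [ae_restrict_mem hU] with ζ hζ
        rw [norm_norm]; exact hmaj ζ hζ
    _ = (∫ ζ in U, (Metric.ball w r).indicator (fun ζ => ‖(ζ - w)⁻¹‖) ζ) + ∫ ζ in U, r⁻¹ :=
        integral_add hI2.integrableOn (by
          refine (integrableOn_const_iff (C := r⁻¹)).2 (Or.inr hvfin.lt_top))
    _ ≤ (∫ ζ, (Metric.ball w r).indicator (fun ζ => ‖(ζ - w)⁻¹‖) ζ) + ε / 2 := by
        gcongr
        · filter_upwards with ζ
          exact indicator_nonneg (fun _ _ => norm_nonneg _) _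
        · exact Measure.restrict_le_self
        · rw [setIntegral_const, smul_eq_mul]
          have : volume.real U ≤ ε / 2 * r := by
            rw [Measure.real]
            exact ENNReal.toReal_le_of_le_ofReal (by positivity) hv
          calc volume.real U * r⁻¹ ≤ ε / 2 * r * r⁻¹ := by gcongr
            _ = ε / 2 := by field_simp
    _ ≤ ε / 2 + ε / 2 := by
        gcongr
        rw [integral_indicator measurableSet_ball]
        have hp := (measurePreserving_sub_right (volume : Measure ℂ) w)
        have := hp.setIntegral_preimage_emb (Homeomorph.subRight w).measurableEmbedding
          (fun ζ : ℂ => ‖ζ‖⁻¹) (Metric.ball 0 r)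
        have hpre : (fun x => x - w) ⁻¹' Metric.ball 0 r = Metric.ball w r := by
          ext z; simp [dist_eq_norm]
        rw [hpre] at this
        simp only [norm_inv]
        rw [this]
        exact hn.le
    _ = ε := by ring
end UC
end

noncomputable section
namespace UC
open Set Filter Topology

section dens
variable {k : ℕ} (Γ : Set (Fin k → ℂ))

def crd (j : Fin k) : C(Γ, ℂ) := ⟨fun z => z.1 j, (continuous_apply j).comp continuous_subtype_val⟩

def evp : MvPolynomial (Fin k) ℂ →ₐ[ℂ] C(Γ, ℂ) := MvPolynomial.aeval (crd Γ)

lemma evp_apply (p : MvPolynomial (Fin k) ℂ) (z : Γ) : evp Γ p z = MvPolynomial.eval z.1 p := by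
  have h : ((ContinuousMap.evalAlgHom ℂ ℂ z).comp (evp Γ)) = MvPolynomial.aeval z.1 := by
    apply MvPolynomial.algHom_ext
    intro i
    simp [evp, crd]
  have := congrArg (fun φ => φ p) h
  simpa [MvPolynomial.aeval_eq_eval] using this

variable [CompactSpace Γ]

abbrev PAlg : Subalgebra ℂ C(Γ, ℂ) := (evp Γ).range.topologicalClosure

instance : CompleteSpace (PAlg Γ) :=
  (Subalgebra.isClosed_topologicalClosure _).completeSpace_coe

lemma evp_mem (p : MvPolynomial (Fin k) ℂ) : evp Γ p ∈ PAlg Γ :=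
  Subalgebra.le_topologicalClosure _ ⟨p, rfl⟩

lemma crd_mem (j : Fin k) : crd Γ j ∈ PAlg Γ := by
  have := evp_mem Γ (MvPolynomial.X j)
  simpa [evp] using this

lemma isUnit_sub [Nonempty Γ] (hh : polyHull Γ = Γ) (j : Fin k) (ζ : ℂ)
    (hζ : ζ ∉ (fun z : Fin k → ℂ => z j) '' Γ) :
    IsUnit (algebraMap ℂ (PAlg Γ) ζ - ⟨crd Γ j, crd_mem Γ j⟩) := by
  by_contra hn
  obtain ⟨φ, hφ⟩ := WeakDual.CharacterSpace.exists_apply_eq_zero hn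
  rw [map_sub, AlgHomClass.commutes, sub_eq_zero] at hφ
  simp only [Algebra.algebraMap_self, RingHom.id_apply] at hφ
  let w : Fin k → ℂ := fun i => φ ⟨crd Γ i, crd_mem Γ i⟩
  have hw : ∀ p, φ ⟨evp Γ p, evp_mem Γ p⟩ = MvPolynomial.eval w p := by
    intro p
    let ψ : MvPolynomial (Fin k) ℂ →ₐ[ℂ] ℂ :=
      (WeakDual.CharacterSpace.toAlgHom φ).comp ((evp Γ).codRestrict (PAlg Γ) (evp_mem Γ))
    have h : ψ = MvPolynomial.aeval w := by
      apply MvPolynomial.algHom_ext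
      intro i
      have : (evp Γ).codRestrict (PAlg Γ) (evp_mem Γ) (MvPolynomial.X i) = ⟨crd Γ i, crd_mem Γ i⟩ := by
        apply Subtype.ext
        simp [evp]
      rw [MvPolynomial.aeval_X]
      exact congrArg φ this
    have := congrArg (fun φ => φ p) h
    simp only [MvPolynomial.aeval_eq_eval] at this
    exact this
  apply hζ
  have hmem : w ∈ polyHull Γ := by
    intro p M hM
    rw [← hw p]
    have : NormOneClass (PAlg Γ) := ⟨by
      show ‖(1 : C(Γ, ℂ))‖ = 1
      exact norm_one⟩
    refine (AlgHom.norm_apply_le_self φ _).trans ?_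
    show ‖evp Γ p‖ ≤ M
    rw [ContinuousMap.norm_le_of_nonempty]
    intro z
    rw [evp_apply]
    exact hM _ z.2
  rw [hh] at hmem
  exact ⟨w, hmem, hφ.symm⟩

lemma conj_mem [Nonempty Γ] (hh : polyHull Γ = Γ) (j : Fin k)
    (hnull : volume ((fun z : Fin k → ℂ => z j) '' Γ) = 0) :
    star (crd Γ j) ∈ PAlg Γ := by
  have hcl : IsClosed (PAlg Γ : Set C(Γ, ℂ)) := Subalgebra.isClosed_topologicalClosure _
  show _ ∈ (PAlg Γ : Set C(Γ, ℂ))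
  rw [← hcl.closure_eq, Metric.mem_closure_iff]
  intro ε hε
  set K := (fun z : Fin k → ℂ => z j) '' Γ with hK
  have hΓc : IsCompact Γ := isCompact_iff_compactSpace.2 inferInstance
  have hKc : IsCompact K := hΓc.image (by fun_prop)
  obtain ⟨R, hR⟩ : ∃ R, ∀ w ∈ K, ‖w‖ < R := by
    obtain ⟨R, hR⟩ := hKc.isBounded.exists_norm_le
    exact ⟨R + 1, fun w hw => by linarith [hR w hw]⟩
  obtain ⟨δ, hδ, hpot⟩ := small_pot (half_pos hε)
  obtain ⟨U, hKU, hUo, hUv⟩ := K.exists_isOpen_lt_of_lt (μ := volume) (ENNReal.ofReal δ)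
    (by rw [hnull]; exact ENNReal.ofReal_pos.2 hδ)
  set c : PAlg Γ := ⟨crd Γ j, crd_mem Γ j⟩ with hc
  let F : ℂ → PAlg Γ := fun ζ => Ring.inverse (algebraMap ℂ (PAlg Γ) ζ - c)
  have hunit : ∀ ζ ∉ U, IsUnit (algebraMap ℂ (PAlg Γ) ζ - c) :=
    fun ζ hζ => isUnit_sub Γ hh j ζ (fun h => hζ (hKU h))
  have hFc : ContinuousOn F (Metric.closedBall 0 R \ U) := by
    intro ζ hζ
    apply ContinuousAt.continuousWithinAt
    obtain ⟨x, hx⟩ := hunit ζ hζ.2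
    have h1 := NormedRing.inverse_continuousAt x
    rw [hx] at h1
    exact ContinuousAt.comp (f := fun ζ => algebraMap ℂ (PAlg Γ) ζ - c) h1
      (((continuous_algebraMap ℂ (PAlg Γ)).sub continuous_const).continuousAt)
  have hFi : IntegrableOn F (Metric.ball 0 R \ U) := by
    refine (hFc.integrableOn_compact ?_).mono_set (sdiff_subset_sdiff_left Metric.ball_subset_closedBall)
    exact (isCompact_closedBall _ _).diff hUo
  let b : PAlg Γ := ((-Real.pi : ℂ)⁻¹) • ∫ ζ in Metric.ball 0 R \ U, F ζ
  have hb : ∀ z : Γ, (b : C(Γ, ℂ)) z = (-Real.pi : ℂ)⁻¹ *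
      ∫ ζ in Metric.ball 0 R \ U, (ζ - z.1 j)⁻¹ := by
    intro z
    let ev : PAlg Γ →L[ℂ] ℂ :=
      (ContinuousMap.evalCLM ℂ z).comp (PAlg Γ).toSubmodule.subtypeL
    have h1 : (b : C(Γ, ℂ)) z = ev b := rfl
    rw [h1, map_smul, ← ContinuousLinearMap.integral_comp_comm ev hFi, smul_eq_mul]
    congr 1
    refine setIntegral_congr_fun (measurableSet_ball.diff hUo.measurableSet) (fun ζ hζ => ?_)
    have h2 := Ring.mul_inverse_cancel _ (hunit ζ hζ.2)
    have h3 := congrArg (fun g : PAlg Γ => (g : C(Γ, ℂ)) z) h2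
    have h4 : (ζ - z.1 j) * ev (F ζ) = 1 := h3
    exact eq_inv_of_mul_eq_one_right h4
  refine ⟨b, b.2, ?_⟩
  refine lt_of_le_of_lt ?_ (half_lt_self hε)
  rw [ContinuousMap.dist_le (half_pos hε).le]
  intro z
  have hzK : z.1 j ∈ K := ⟨z.1, z.2, rfl⟩
  have hs := integral_inter_add_sdiff (μ := volume) (s := Metric.ball (0:ℂ) R) (t := U) hUo.measurableSet
    (int_inv'' (z.1 j) R)
  rw [cauchyT (hR _ hzK)] at hs
  have hsm := hpot (Metric.ball 0 R ∩ U) (measurableSet_ball.inter hUo.measurableSet)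
    ((measure_mono inter_subset_right).trans hUv.le) (z.1 j)
  rw [hb z, eq_sub_iff_add_eq'.2 hs]
  have hst : (star (crd Γ j)) z = (starRingEnd ℂ) (z.1 j) := rfl
  rw [hst, dist_eq_norm]
  have hpi : (Real.pi : ℂ) ≠ 0 := by exact_mod_cast Real.pi_ne_zero
  have : (starRingEnd ℂ) (z.1 j) - (-Real.pi : ℂ)⁻¹ * (-Real.pi * (starRingEnd ℂ) (z.1 j) -
      ∫ ζ in Metric.ball 0 R ∩ U, (ζ - z.1 j)⁻¹) =
      - (Real.pi : ℂ)⁻¹ * ∫ ζ in Metric.ball 0 R ∩ U, (ζ - z.1 j)⁻¹ := by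
    field_simp
    ring
  rw [this, norm_mul, norm_neg, norm_inv, Complex.norm_real, Real.norm_of_nonneg Real.pi_pos.le]
  calc Real.pi⁻¹ * _ ≤ 1 * _ := by
        gcongr
        exact inv_le_one_of_one_le₀ (by linarith [Real.pi_gt_three])
    _ ≤ ε / 2 := by rw [one_mul]; exact hsm

lemma palg_top [Nonempty Γ] (hh : polyHull Γ = Γ)
    (hnull : ∀ j, volume ((fun z : Fin k → ℂ => z j) '' Γ) = 0) : PAlg Γ = ⊤ := by
  let S : StarSubalgebra ℂ C(Γ, ℂ) := StarAlgebra.adjoin ℂ (range (crd Γ))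
  have hsep : S.SeparatesPoints := by
    intro x y hxy
    have : ∃ j, x.1 j ≠ y.1 j := by
      by_contra h
      push Not at h
      exact hxy (Subtype.ext (funext h))
    obtain ⟨j, hj⟩ := this
    exact ⟨crd Γ j, ⟨crd Γ j, StarAlgebra.subset_adjoin ℂ _ ⟨j, rfl⟩, rfl⟩, hj⟩
  have htop := ContinuousMap.starSubalgebra_topologicalClosure_eq_top_of_separatesPoints S hsep
  have hle : S.toSubalgebra ≤ PAlg Γ := by
    rw [StarAlgebra.adjoin_toSubalgebra]
    apply Algebra.adjoin_le
    rintro x (⟨j, rfl⟩ | hx)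
    · exact crd_mem Γ j
    · obtain ⟨j, hj⟩ := hx
      have : x = star (crd Γ j) := by rw [hj, star_star]
      rw [this]
      exact conj_mem Γ hh j (hnull j)
  rw [eq_top_iff]
  intro x _
  have hx : x ∈ S.topologicalClosure := by rw [htop]; trivial
  have hx' : x ∈ closure (S : Set C(Γ, ℂ)) := hx
  have hcl : IsClosed (PAlg Γ : Set C(Γ, ℂ)) := Subalgebra.isClosed_topologicalClosure _
  exact closure_minimal (fun y hy => hle hy) hcl hx'

end dens

lemma poly_dense {k : ℕ} {Γ : Set (Fin k → ℂ)} (hc : IsCompact Γ) (hne : Γ.Nonempty)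
    (hh : polyHull Γ = Γ) (hnull : ∀ j, volume ((fun z : Fin k → ℂ => z j) '' Γ) = 0)
    (F : (Fin k → ℂ) → ℂ) (hF : ContinuousOn F Γ) {ε : ℝ} (hε : 0 < ε) :
    ∃ p : MvPolynomial (Fin k) ℂ, ∀ z ∈ Γ, ‖MvPolynomial.eval z p - F z‖ < ε := by
  have := isCompact_iff_compactSpace.1 hc
  have := hne.to_subtype
  let g : C(Γ, ℂ) := ⟨Γ.domRestrict F, hF.domRestrict⟩
  have hg : g ∈ PAlg Γ := by rw [palg_top Γ hh hnull]; trivial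
  have hg' : g ∈ closure ((evp Γ).range : Set C(Γ, ℂ)) := hg
  obtain ⟨b, ⟨p, rfl⟩, hp⟩ := Metric.mem_closure_iff.1 hg' ε hε
  refine ⟨p, fun z hz => ?_⟩
  have := (ContinuousMap.dist_lt_iff hε).1 hp ⟨z, hz⟩
  rw [dist_comm, dist_eq_norm] at this
  have h2 := evp_apply Γ p ⟨z, hz⟩
  rw [← h2]; exact this

lemma null_of_gr {k : ℕ} {Γ : Set (Fin k → ℂ)} {p₀} (G : Gr Γ p₀) (j : Fin k) :
    volume ((fun z : Fin k → ℂ => z j) '' Γ) = 0 := by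
  have := G.fin
  have h : (fun z : Fin k → ℂ => z j) '' Γ = ⋃ e, (fun u => G.f e u j) '' Icc 0 1 := by
    conv_lhs => rw [G.cover, image_iUnion]
    simp only [image_image]
  rw [h, measure_iUnion_null_iff]
  intro e
  obtain ⟨K, hK⟩ := G.lip e
  have hl : LipschitzWith K (fun u => G.f e u j) := by
    have := (LipschitzWith.eval (α := fun _ : Fin k => ℂ) j).comp hK
    simp only [one_mul] at this
    exact this
  have hl2 := (Complex.equivRealProdCLM : ℂ →L[ℝ] ℝ × ℝ).lipschitz.comp hl
  have hd := hl2.dimH_image_le (Icc 0 1)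
  rw [image_comp] at hd
  have hd1 : dimH (Icc (0:ℝ) 1) ≤ 1 := (dimH_mono (subset_univ _)).trans Real.dimH_univ.le
  have hz : volume ((Complex.equivRealProdCLM : ℂ →L[ℝ] ℝ × ℝ) '' ((fun u => G.f e u j) '' Icc 0 1)) = 0 := by
    rw [← hausdorffMeasure_prod_real]
    have := hausdorffMeasure_of_dimH_lt (d := 2) ((hd.trans hd1).trans_lt (by norm_num))
    exact_mod_cast this
  have := Complex.volume_preserving_equiv_real_prod.measure_preimage_equiv
    ((Complex.equivRealProdCLM : ℂ →L[ℝ] ℝ × ℝ) '' ((fun u => G.f e u j) '' Icc 0 1))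
  rw [hz] at this
  refine measure_mono_null ?_ this
  intro x hx
  exact ⟨x, hx, rfl⟩
end UC
end

noncomputable section
namespace UC
open Set Filter Topology

lemma lipOn_int {a : ℝ → ℂ} (ha : ∀ s t, IntervalIntegrable a volume s t) {x : ℝ} {C : NNReal}
    (hC : ∀ r ∈ uIcc 0 x, ‖a r‖ ≤ C) :
    LipschitzOnWith C (fun v => ∫ r in (0:ℝ)..v, a r) (uIcc 0 x) := by
  refine LipschitzOnWith.of_dist_le_mul fun s hs t ht => ?_
  rw [dist_eq_norm, intervalIntegral.integral_interval_sub_left (ha _ _) (ha _ _), dist_comm,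
    Real.dist_eq, abs_sub_comm]
  refine intervalIntegral.norm_integral_le_of_norm_le_const fun r hr => hC r ?_
  exact (uIcc_subset_uIcc ht hs) (uIoc_subset_uIcc hr)

lemma ibp {a b : ℝ → ℂ} (ha : ∀ s t, IntervalIntegrable a volume s t)
    (hb : ∀ s t, IntervalIntegrable b volume s t) (x : ℝ) {C : NNReal}
    (hCa : ∀ r ∈ uIcc 0 x, ‖a r‖ ≤ C) (hCb : ∀ r ∈ uIcc 0 x, ‖b r‖ ≤ C) :
    (∫ r in (0:ℝ)..x, a r) * (∫ r in (0:ℝ)..x, b r) =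
      (∫ r in (0:ℝ)..x, a r * ∫ t in (0:ℝ)..r, b t) +
      ∫ r in (0:ℝ)..x, b r * ∫ t in (0:ℝ)..r, a t := by
  set A : ℝ → ℂ := fun v => ∫ r in (0:ℝ)..v, a r with hA
  set B : ℝ → ℂ := fun v => ∫ r in (0:ℝ)..v, b r with hB
  have hAc : Continuous A := intervalIntegral.continuous_primitive ha 0
  have hBc : Continuous B := intervalIntegral.continuous_primitive hb 0
  have hlA := lipOn_int ha hCa
  have hlB := lipOn_int hb hCb
  obtain ⟨MA, hMA⟩ := isCompact_uIcc.exists_bound_of_continuousOn (hAc.continuousOn (s := uIcc 0 x))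
  obtain ⟨MB, hMB⟩ := isCompact_uIcc.exists_bound_of_continuousOn (hBc.continuousOn (s := uIcc 0 x))
  have hMA0 : 0 ≤ MA := (norm_nonneg _).trans (hMA 0 left_mem_uIcc)
  have hMB0 : 0 ≤ MB := (norm_nonneg _).trans (hMB 0 left_mem_uIcc)
  have i1 : IntervalIntegrable (fun r => a r * B r) volume 0 x :=
    (ha _ _).mul_continuousOn hBc.continuousOn
  have i2 : IntervalIntegrable (fun r => b r * A r) volume 0 x :=
    (hb _ _).mul_continuousOn hAc.continuousOn
  have key := ftc (φ := fun r => A r * B r) (ψ := fun r => a r * B r + b r * A r) (s := 0) (t := x)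
    (K := C * (MA.toNNReal + MB.toNNReal)) ?_ ?_ (i1.add i2)
  · rw [intervalIntegral.integral_add i1 i2] at key
    simp only [hA, hB, intervalIntegral.integral_same, mul_zero, sub_zero] at key ⊢
    exact key.symm
  · refine LipschitzOnWith.of_dist_le_mul fun s hs t ht => ?_
    have h1 := hlA.dist_le_mul s hs t ht
    have h2 := hlB.dist_le_mul s hs t ht
    rw [dist_eq_norm] at h1 h2 ⊢
    have e : A s * B s - A t * B t = A s * (B s - B t) + (A s - A t) * B t := by ring
    rw [e]
    have h3 := hMA s hs
    have h4 := hMB t ht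
    have hd := dist_nonneg (x := s) (y := t)
    calc ‖A s * (B s - B t) + (A s - A t) * B t‖
        ≤ ‖A s‖ * ‖B s - B t‖ + ‖A s - A t‖ * ‖B t‖ := by
          refine (norm_add_le _ _).trans ?_
          rw [norm_mul, norm_mul]
      _ ≤ MA * (C * dist s t) + (C * dist s t) * MB := by gcongr
      _ = _ := by
          push_cast
          rw [Real.coe_toNNReal _ hMA0, Real.coe_toNNReal _ hMB0]; ring
  · filter_upwards [_root_.LocallyIntegrable.ae_hasDerivAt_integral (loc_int ha),
      _root_.LocallyIntegrable.ae_hasDerivAt_integral (loc_int hb)] with r h1 h2 _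
    have := (h1 0).mul (h2 0)
    refine HasDerivAt.congr_deriv this ?_
    simp only [hA, hB]
    ring

section ii
variable {k : ℕ}

def II (α : Fin k → ℝ → ℂ) : List (Fin k) → ℝ → ℂ
  | [], _ => 1
  | i :: l, x => ∫ s in (0:ℝ)..x, α i s * II α l s

variable {α : Fin k → ℝ → ℂ} (hm : ∀ i, Measurable (α i)) {C : NNReal} (hC : ∀ i t, ‖α i t‖ ≤ C)
include hm hC

lemma ai_ii (i : Fin k) {f : ℝ → ℂ} (hf : Continuous f) (s t : ℝ) :
    IntervalIntegrable (fun r => α i r * f r) volume s t :=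
  (ii_of_bdd (hm i) (hC i) s t).mul_continuousOn hf.continuousOn

lemma II_cont (l : List (Fin k)) : Continuous (II α l) := by
  induction l with
  | nil => exact continuous_const
  | cons i l ih => exact intervalIntegral.continuous_primitive (ai_ii hm hC i ih) 0

omit hm hC in
/-- span of iterated integrals -/
def WW (α : Fin k → ℝ → ℂ) : Submodule ℂ (ℝ → ℂ) := Submodule.span ℂ (range (II α))

lemma WW_cont {f : ℝ → ℂ} (hf : f ∈ WW α) : Continuous f := by
  refine Submodule.span_induction ?_ ?_ ?_ ?_ hf
  · rintro _ ⟨l, rfl⟩; exact II_cont hm hC l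
  · exact continuous_const
  · intro f g _ _ h1 h2; exact h1.add h2
  · intro c f _ h; exact h.const_smul c

lemma WW_int (i : Fin k) {f : ℝ → ℂ} (hf : f ∈ WW α) :
    (fun x => ∫ s in (0:ℝ)..x, α i s * f s) ∈
      Submodule.span ℂ ((II α) '' {l | l ≠ []}) := by
  refine Submodule.span_induction ?_ ?_ ?_ ?_ hf
  · rintro _ ⟨l, rfl⟩
    exact Submodule.subset_span ⟨i :: l, by simp, rfl⟩
  · have : (fun x => ∫ s in (0:ℝ)..x, α i s * (0 : ℝ → ℂ) s) = 0 := by ext x; simp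
    rw [this]; exact Submodule.zero_mem _
  · intro f g hf hg h1 h2
    have : (fun x => ∫ s in (0:ℝ)..x, α i s * (f + g) s) =
        (fun x => ∫ s in (0:ℝ)..x, α i s * f s) + fun x => ∫ s in (0:ℝ)..x, α i s * g s := by
      ext x
      simp only [Pi.add_apply, mul_add]
      exact intervalIntegral.integral_add (ai_ii hm hC i (WW_cont hm hC hf) _ _)
        (ai_ii hm hC i (WW_cont hm hC hg) _ _)
    rw [this]; exact Submodule.add_mem _ h1 h2
  · intro c f _ h
    have : (fun x => ∫ s in (0:ℝ)..x, α i s * (c • f) s) =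
        c • fun x => ∫ s in (0:ℝ)..x, α i s * f s := by
      ext x
      simp only [Pi.smul_apply, smul_eq_mul, mul_left_comm (α i _) c]
      exact intervalIntegral.integral_const_mul _ _
    rw [this]; exact Submodule.smul_mem _ _ h

lemma WW_int' (i : Fin k) {f : ℝ → ℂ} (hf : f ∈ WW α) :
    (fun x => ∫ s in (0:ℝ)..x, α i s * f s) ∈ WW α :=
  Submodule.span_mono (image_subset_range _ _) (WW_int hm hC i hf)

omit hm hC in
lemma II_bdd (hC : ∀ i t, ‖α i t‖ ≤ C) (i : Fin k) {f : ℝ → ℂ} (hf : Continuous f) (x : ℝ) :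
    ∃ D : NNReal, ∀ r ∈ uIcc 0 x, ‖α i r * f r‖ ≤ D := by
  obtain ⟨M, hM⟩ := isCompact_uIcc.exists_bound_of_continuousOn (hf.continuousOn (s := uIcc 0 x))
  refine ⟨C * M.toNNReal, fun r hr => ?_⟩
  rw [norm_mul]
  push_cast
  exact mul_le_mul (hC i r) ((hM r hr).trans (Real.le_coe_toNNReal M)) (norm_nonneg _) C.2

lemma II_mul (n : ℕ) : ∀ l m : List (Fin k), l.length + m.length = n →
    II α l * II α m ∈ WW α := by
  induction n using Nat.strong_induction_on with
  | _ n ih =>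
    intro l m hn
    match l, m with
    | [], m =>
      have : II α [] * II α m = II α m := by ext x; simp [II]
      rw [this]; exact Submodule.subset_span ⟨m, rfl⟩
    | l, [] =>
      have : II α l * II α [] = II α l := by ext x; simp [II]
      rw [this]; exact Submodule.subset_span ⟨l, rfl⟩
    | i :: l, j :: m =>
      have e : II α (i :: l) * II α (j :: m) =
          (fun x => ∫ s in (0:ℝ)..x, α i s * (II α l * II α (j :: m)) s) +
          fun x => ∫ s in (0:ℝ)..x, α j s * (II α m * II α (i :: l)) s := by
        ext x
        obtain ⟨D, hD⟩ := II_bdd hC i (II_cont hm hC l) x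
        obtain ⟨D', hD'⟩ := II_bdd hC j (II_cont hm hC m) x
        have := ibp (ai_ii hm hC i (II_cont hm hC l)) (ai_ii hm hC j (II_cont hm hC m)) x
          (C := max D D') (fun r hr => (hD r hr).trans (by exact_mod_cast le_max_left _ _))
          (fun r hr => (hD' r hr).trans (by exact_mod_cast le_max_right _ _))
        simp only [Pi.add_apply, Pi.mul_apply, ← mul_assoc]
        exact this
      rw [e]
      simp only [List.length_cons] at hn
      refine Submodule.add_mem _ (WW_int' hm hC i ?_) (WW_int' hm hC j ?_)
      · exact ih (n - 1) (by omega) _ _ (by simp only [List.length_cons]; omega)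
      · exact ih (n - 1) (by omega) _ _ (by simp only [List.length_cons]; omega)

lemma WW_mul {f g : ℝ → ℂ} (hf : f ∈ WW α) (hg : g ∈ WW α) : f * g ∈ WW α := by
  refine Submodule.span_induction ?_ ?_ ?_ ?_ hf
  · rintro _ ⟨l, rfl⟩
    refine Submodule.span_induction ?_ ?_ ?_ ?_ hg
    · rintro _ ⟨m, rfl⟩; exact II_mul hm hC _ l m rfl
    · rw [mul_zero]; exact Submodule.zero_mem _
    · intro f g _ _ h1 h2; rw [mul_add]; exact Submodule.add_mem _ h1 h2
    · intro c f _ h; rw [mul_smul_comm]; exact Submodule.smul_mem _ _ h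
  · rw [zero_mul]; exact Submodule.zero_mem _
  · intro f g _ _ h1 h2; rw [add_mul]; exact Submodule.add_mem _ h1 h2
  · intro c f _ h; rw [smul_mul_assoc]; exact Submodule.smul_mem _ _ h

lemma WW_poly (p : MvPolynomial (Fin k) ℂ) : (fun t => MvPolynomial.eval (PA α t) p) ∈ WW α := by
  induction p using MvPolynomial.induction_on with
  | C a =>
    have : (fun t => MvPolynomial.eval (PA α t) (MvPolynomial.C a)) = a • II α [] := by
      ext t; simp [II]
    rw [this]; exact Submodule.smul_mem _ _ (Submodule.subset_span ⟨[], rfl⟩)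
  | add p q hp hq =>
    have : (fun t => MvPolynomial.eval (PA α t) (p + q)) =
      (fun t => MvPolynomial.eval (PA α t) p) + fun t => MvPolynomial.eval (PA α t) q := by
      ext t; simp
    rw [this]; exact Submodule.add_mem _ hp hq
  | mul_X p i hp =>
    have : (fun t => MvPolynomial.eval (PA α t) (p * MvPolynomial.X i)) =
      (fun t => MvPolynomial.eval (PA α t) p) * II α [i] := by
      ext t; simp [II, PA]
    rw [this]; exact WW_mul hm hC hp (Submodule.subset_span ⟨[i], rfl⟩)

/-- polynomial forms: transport of the vacuum -/
lemma poly_sol (h : ℕ → Fin k → MvPolynomial (Fin k) ℂ) (p : ℕ) :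
    sol (bform (fun p i z => MvPolynomial.eval z (h p i)) α) 0 (Pi.single 0 1) (p+1) ∈
      Submodule.span ℂ ((II α) '' {l | l ≠ []}) := by
  have step : ∀ p, sol (bform (fun p i z => MvPolynomial.eval z (h p i)) α) 0 (Pi.single 0 1) p ∈ WW α →
      sol (bform (fun p i z => MvPolynomial.eval z (h p i)) α) 0 (Pi.single 0 1) (p+1) ∈
      Submodule.span ℂ ((II α) '' {l | l ≠ []}) := by
    intro p hp
    set S := sol (bform (fun p i z => MvPolynomial.eval z (h p i)) α) 0 (Pi.single 0 1) with hS
    have hf : ∀ i, (fun t => MvPolynomial.eval (PA α t) (h p i)) * S p ∈ WW α :=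
      fun i => WW_mul hm hC (WW_poly hm hC _) hp
    have e : S (p+1) = ∑ i, fun x => ∫ s in (0:ℝ)..x, α i s *
        ((fun t => MvPolynomial.eval (PA α t) (h p i)) * S p) s := by
      ext x
      rw [Finset.sum_apply, ← intervalIntegral.integral_finsetSum]
      · rw [hS]
        simp only [sol]
        rw [Pi.single_eq_of_ne (by omega), zero_add]
        refine intervalIntegral.integral_congr fun r _ => ?_
        simp only [bform, Finset.sum_mul, Pi.mul_apply]
        refine Finset.sum_congr rfl fun i _ => by ring
      · intro i _
        exact ai_ii hm hC i (WW_cont hm hC (hf i)) _ _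
    rw [e]
    exact Submodule.sum_mem _ fun i _ => WW_int hm hC i (hf i)
  apply step
  induction p with
  | zero =>
    have : sol (bform (fun p i z => MvPolynomial.eval z (h p i)) α) 0 (Pi.single 0 1) 0 = II α [] := by
      ext x; simp [sol, II]
    rw [this]; exact Submodule.subset_span ⟨[], rfl⟩
  | succ p ih => exact Submodule.span_mono (image_subset_range _ _) (step p ih)

omit hm hC in
lemma span_zero {T : ℝ} (hU : ∀ l : List (Fin k), l ≠ [] → II α l T = 0) {f : ℝ → ℂ}
    (hf : f ∈ Submodule.span ℂ ((II α) '' {l | l ≠ []})) : f T = 0 := by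
  refine Submodule.span_induction ?_ ?_ ?_ ?_ hf
  · rintro _ ⟨l, hl, rfl⟩; exact hU l hl
  · rfl
  · intro f g _ _ h1 h2; rw [Pi.add_apply, h1, h2, add_zero]
  · intro c f _ h; rw [Pi.smul_apply, h, smul_zero]

end ii

lemma cont_sol {k : ℕ} {Γ : Set (Fin k → ℂ)} {α : Fin k → ℝ → ℂ} (hA : Adm Γ α)
    (hc : IsCompact Γ) (hh : polyHull Γ = Γ)
    (hnull : ∀ j, volume ((fun z : Fin k → ℂ => z j) '' Γ) = 0) {T : ℝ}
    (hU : ∀ l : List (Fin k), l ≠ [] → II α l T = 0)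
    (c : ℕ → Fin k → (Fin k → ℂ) → ℂ) (hcc : ∀ p i, ContinuousOn (c p i) Γ) (p : ℕ) :
    sol (bform c α) 0 (Pi.single 0 1) (p+1) T = 0 := by
  obtain ⟨C, hC⟩ := hA.bdd
  have hne : Γ.Nonempty := ⟨_, hA.inΓ 0⟩
  have hex : ∀ (n : ℕ) p i, ∃ P : MvPolynomial (Fin k) ℂ, ∀ z ∈ Γ,
      ‖MvPolynomial.eval z P - c p i z‖ < 1 / ((n : ℝ) + 1) := fun n p i =>
    poly_dense hc hne hh hnull (c p i) (hcc p i) (by positivity)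
  choose P hP using hex
  have hb : ∀ p i, ∃ D : ℝ, ∀ z ∈ Γ, ‖c p i z‖ ≤ D := fun p i =>
    hc.exists_bound_of_continuousOn (hcc p i)
  choose D hD using hb
  have hlim := sol_tendsto (βn := fun n => bform (fun p i z => MvPolynomial.eval z (P n p i)) α)
    (β := bform c α) (fun n => hA.nice hc (fun p i => (MvPolynomial.continuous_eval _).continuousOn))
    (fun p => ∑ i, (1 + D p i) * C) ?_ ?_ 0 (Pi.single 0 1) (p+1) T
  · refine tendsto_nhds_unique hlim ?_
    have : ∀ n, sol (bform (fun p i z => MvPolynomial.eval z (P n p i)) α) 0 (Pi.single 0 1) (p+1) T = 0 :=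
      fun n => span_zero hU (poly_sol hA.meas hC _ p)
    simp only [this]
    exact tendsto_const_nhds
  · intro n p t
    refine (norm_sum_le _ _).trans (Finset.sum_le_sum fun i _ => ?_)
    rw [norm_mul]
    have h1 := hP n p i _ (hA.inΓ t)
    have h2 := hD p i _ (hA.inΓ t)
    have h3 : 1 / ((n : ℝ) + 1) ≤ 1 := by
      rw [div_le_one (by positivity)]; linarith [n.cast_nonneg (α := ℝ)]
    have h4 : ‖MvPolynomial.eval (PA α t) (P n p i)‖ ≤ 1 + D p i := by
      have := norm_add_le (MvPolynomial.eval (PA α t) (P n p i) - c p i (PA α t)) (c p i (PA α t))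
      rw [sub_add_cancel] at this
      linarith
    exact mul_le_mul h4 (hC i t) (norm_nonneg _) ((norm_nonneg _).trans h4)
  · intro p
    filter_upwards with t
    refine tendsto_finsetSum _ fun i _ => Tendsto.mul_const _ ?_
    rw [tendsto_iff_norm_sub_tendsto_zero]
    refine squeeze_zero (fun _ => norm_nonneg _) (fun n => (hP n p i _ (hA.inΓ t)).le) ?_
    exact tendsto_one_div_add_atTop_nhds_zero_nat
end UC
end

noncomputable section
namespace UC
open Set Filter Topology

section alg
variable {E : Type} [DecidableEq E]

def dF (ε : ℕ → Option E) (e : E) (n : ℤ) (x : ℕ → ℂ) : ℕ → ℂ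
  | 0 => x 0
  | p + 1 => x (p+1) + if ε p = some e then (n:ℂ) * x p else 0

variable {ε : ℕ → Option E} (hε : ∀ p e, ε p = some e → ε (p+1) ≠ some e)
include hε

lemma dF_add (e : E) (m n : ℤ) (x : ℕ → ℂ) : dF ε e m (dF ε e n x) = dF ε e (m+n) x := by
  ext p
  cases p with
  | zero => rfl
  | succ p =>
    rw [dF, dF.eq_2, dF.eq_2]
    by_cases h : ε p = some e
    · simp only [h, if_true]
      have : dF ε e n x p = x p := by
        cases p with
        | zero => rfl
        | succ p =>
          simp only [dF]
          rw [if_neg, add_zero]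
          intro h'; exact hε p e h' h
      rw [this]; push_cast; ring
    · simp [h]

variable {J : E → Equiv.Perm (ℕ → ℂ)} (hJ : ∀ e x, J e x = dF ε e 1 x)
include hJ

omit hε hJ in
lemma dF_zero (e : E) (x : ℕ → ℂ) : dF ε e 0 x = x := by
  ext p; cases p <;> simp [dF]

lemma J_zpow (e : E) (n : ℤ) (x : ℕ → ℂ) : (J e ^ n) x = dF ε e n x := by
  have hnat : ∀ (n : ℕ) x, (J e ^ n) x = dF ε e n x := by
    intro n
    induction n with
    | zero => intro x; simp [dF_zero]
    | succ n ih =>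
      intro x
      rw [pow_succ', Equiv.Perm.mul_apply, ih, hJ, dF_add hε]
      congr 1; push_cast; ring
  rcases n with n | n
  · simpa using hnat n x
  · rw [zpow_negSucc, Equiv.Perm.inv_eq_iff_eq, hnat, dF_add hε]
    rw [Int.negSucc_eq]
    push_cast
    rw [add_neg_cancel, dF_zero]

lemma detect (L : List (Σ _ : E, Multiplicative ℤ)) (hne : ∀ l ∈ L, l.2 ≠ 1)
    (hL : ∀ pre l L', L = pre ++ l :: L' → ε L'.length = some l.1) :
    ((L.map (fun l => J l.1 ^ (Multiplicative.toAdd l.2))).prod (Pi.single 0 1)) L.length ≠ 0 ∧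
    ∀ p, L.length < p →
      ((L.map (fun l => J l.1 ^ (Multiplicative.toAdd l.2))).prod (Pi.single 0 1)) p = 0 := by
  induction L with
  | nil =>
    simp
    intro p hp
    rw [Pi.single_eq_of_ne hp.ne']
  | cons l L ih =>
    have ih := ih (fun l' h => hne l' (by simp [h])) (fun pre l' L' h => hL (l :: pre) l' L' (by simp [h]))
    have h0 := hL [] l L rfl
    simp only [List.map_cons, List.prod_cons, Equiv.Perm.mul_apply, J_zpow hε hJ, List.length_cons]
    constructor
    · simp only [dF, h0, if_true]
      rw [ih.2 _ (by omega), zero_add]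
      refine mul_ne_zero ?_ ih.1
      have := hne l (by simp)
      intro h
      apply this
      rw [Int.cast_eq_zero] at h
      exact h
    · intro p hp
      cases p with
      | zero => omega
      | succ p =>
        simp only [dF]
        rw [ih.2 _ (by omega), ih.2 p (by omega)]
        simp
end alg

variable {k : ℕ} {Γ : Set (Fin k → ℂ)} {p₀ : Fin k → ℂ} {α : Fin k → ℝ → ℂ}

lemma cut_tendsto {u : ℝ} (hu : u ∈ Ioo (0:ℝ) 1) :
    Tendsto (fun n => (cut n u : ℂ)) atTop (𝓝 1) := by
  have hm : 0 < min u (1 - u) := lt_min hu.1 (by linarith [hu.2])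
  obtain ⟨N, hN⟩ := exists_nat_gt (2 / min u (1-u))
  refine tendsto_const_nhds.congr' ?_
  filter_upwards [eventually_ge_atTop N] with n hn
  have h1 : 2 / min u (1-u) < n := lt_of_lt_of_le hN (by exact_mod_cast hn)
  rw [div_lt_iff₀ hm] at h1
  have : cut n u = 1 := by
    unfold cut cl
    rw [min_eq_left (by nlinarith)]
    norm_num
  rw [this]; simp

lemma cut_bd (n : ℕ) (u : ℝ) : ‖(cut n u : ℂ)‖ ≤ 1 := by
  have := cl_mem ((n + 4 : ℝ) * min u (1 - u) - 1)
  rw [Complex.norm_real, Real.norm_eq_abs, abs_le]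
  unfold cut
  exact ⟨by linarith [this.1], this.2⟩

lemma exists_cut (G : Gr Γ p₀) : ∃ (ι : G.E → Fin k) (n : ℕ), ∀ e,
    ∫ v in (0:ℝ)..1, (cut n v : ℂ) * deriv (fun v => G.f e v (ι e)) v ≠ 0 := by
  have := G.fin
  have h1 : ∀ e, ∃ i, G.f e 0 i ≠ G.f e 1 i := by
    intro e
    by_contra h
    push Not at h
    have := G.inj e (by simp) (by simp) (funext h)
    norm_num at this
  choose ι hι using h1
  have h2 : ∀ e, ∀ᶠ n in atTop,
      ∫ v in (0:ℝ)..1, (cut n v : ℂ) * deriv (fun v => G.f e v (ι e)) v ≠ 0 := by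
    intro e
    obtain ⟨K, hK⟩ := G.lip e
    have hl := lip_comp hK (ι e)
    have hlim : Tendsto (fun n => ∫ v in (0:ℝ)..1, (cut n v : ℂ) * deriv (fun v => G.f e v (ι e)) v)
        atTop (𝓝 (∫ v in (0:ℝ)..1, deriv (fun v => G.f e v (ι e)) v)) := by
      refine intervalIntegral.tendsto_integral_filter_of_dominated_convergence (fun _ => (K:ℝ)) ?_ ?_ ?_ ?_
      · filter_upwards with n
        apply Measurable.aestronglyMeasurable
        refine Measurable.mul ?_ (measurable_deriv _)
        have : Continuous (fun u => (cut n u : ℂ)) := by unfold cut cl; fun_prop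
        exact this.measurable
      · filter_upwards with n
        filter_upwards with v _
        rw [norm_mul]
        have := mul_le_mul (cut_bd n v) (lip_bound hl v) (norm_nonneg _) zero_le_one
        rwa [one_mul] at this
      · exact intervalIntegrable_const
      · have h1 : ∀ᵐ v : ℝ, v ≠ 1 := by simp [ae_iff, measure_singleton]
        filter_upwards [h1] with v hv1 hv
        rw [uIoc_of_le zero_le_one] at hv
        have := (cut_tendsto ⟨hv.1, lt_of_le_of_ne hv.2 hv1⟩).mul_const
          (deriv (fun v => G.f e v (ι e)) v)
        rwa [one_mul] at this
    rw [ftc_lip hl] at hlim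
    exact hlim.eventually_ne (sub_ne_zero.2 (hι e).symm)
  obtain ⟨n, hn⟩ := (eventually_all.2 h2).exists
  exact ⟨ι, n, hn⟩

section det
variable (G : Gr Γ p₀) (n : ℕ) (ι : G.E → Fin k)

open Classical in
def Gr.bump (e : G.E) (z : Fin k → ℂ) : ℂ :=
  G.pst (fun e' u => if e' = e then (cut n u : ℂ) else 0) (fun _ => 0) z

open Classical in
lemma Gr.bump_Icc (e e' : G.E) {u : ℝ} (hu : u ∈ Icc (0:ℝ) 1) :
    G.bump n e (G.f e' u) = if e' = e then (cut n u : ℂ) else 0 := by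
  have hn : (0:ℝ) < 1 / (n + 4) := by positivity
  refine G.pst_Icc _ _ (fun e => ?_) (fun e => ?_) e' hu
  · simp only [ite_eq_right_iff]; intro _
    rw [cut_zero]; · simp
    simp only [mem_Icc, not_and_or, not_le]; left; exact hn
  · simp only [ite_eq_right_iff]; intro _
    rw [cut_zero]; · simp
    simp only [mem_Icc, not_and_or, not_le]; right; linarith

open Classical in
def Gr.detForm (c : G.E → ℂ) (ε : ℕ → Option G.E) : Form G (1 / (n + 4)) where
  c p i z := (ε p).elim 0 (fun e => if i = ι e then c e * G.bump n e z else 0)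
  cont p i := by
    cases ε p with
    | none => exact continuousOn_const
    | some e =>
      simp only [Option.elim_some]
      split_ifs
      · refine ContinuousOn.mul continuousOn_const ?_
        apply G.contOn
        intro e'
        have : Continuous (fun u => if e' = e then (cut n u : ℂ) else 0) := by
          split_ifs
          · unfold cut cl; fun_prop
          · exact continuous_const
        exact this.continuousOn.congr (fun u hu => G.bump_Icc n e e' hu)
      · exact continuousOn_const
  supp p i z hz hm := by
    cases ε p with
    | none => rfl
    | some e =>
      simp only [Option.elim_some]
      split_ifs
      · obtain ⟨e', u, hu, rfl⟩ := G.exists_coord hz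
        rw [G.bump_Icc n e e' hu, cut_zero]; · simp
        rwa [G.mid_iff (by positivity) hu] at hm
      · rfl

open Classical in
lemma detForm_pull (c : G.E → ℂ) (ε : ℕ → Option G.E) (e : G.E) (p : ℕ) {v : ℝ} (hv : v ∈ Icc (0:ℝ) 1) :
    pull (G.detForm n ι c ε).c (G.f e) p v =
      if ε p = some e then c e * ((cut n v : ℂ) * deriv (fun v => G.f e v (ι e)) v) else 0 := by
  simp only [pull, Gr.detForm]
  cases h : ε p with
  | none => simp
  | some e' =>
    simp only [Option.elim_some, Option.some.injEq, G.bump_Icc n e' e hv, ite_mul, zero_mul,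
      Finset.sum_ite_eq', Finset.mem_univ, if_true]
    by_cases he : e = e'
    · subst he; simp only [if_true]; ring
    · simp [he, Ne.symm he]

open Classical in
lemma detForm_J {c : G.E → ℂ} (hc : ∀ e, c e * ∫ v in (0:ℝ)..1, (cut n v : ℂ) *
    deriv (fun v => G.f e v (ι e)) v = 1) {ε : ℕ → Option G.E}
    (hε : ∀ p e, ε p = some e → ε (p+1) ≠ some e) (e : G.E) (x : ℕ → ℂ) :
    (G.detForm n ι c ε).J e x = dF ε e 1 x := by
  ext p
  rw [Form.J, Tr_apply]
  have hconst : ∀ p, (p = 0 ∨ ∃ q, p = q + 1 ∧ ε q ≠ some e) → ∀ v ∈ Icc (0:ℝ) 1,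
      sol (pull (G.detForm n ι c ε).c (G.f e)) 0 x p v = x p := by
    rintro p (rfl | ⟨q, rfl, hq⟩) v hv
    · rfl
    · simp only [sol]
      rw [intervalIntegral.integral_congr (g := fun _ => (0:ℂ)), intervalIntegral.integral_zero, add_zero]
      intro r hr
      rw [uIcc_of_le hv.1] at hr
      simp only
      rw [detForm_pull G n ι c ε e q ⟨hr.1, hr.2.trans hv.2⟩, if_neg hq, zero_mul]
  cases p with
  | zero => rfl
  | succ p =>
    simp only [dF]
    by_cases h : ε p = some e
    · simp only [h, if_true, sol]
      congr 1
      have hp := hconst p (by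
        cases p with
        | zero => exact Or.inl rfl
        | succ q => exact Or.inr ⟨q, rfl, fun h' => hε q e h' h⟩)
      rw [intervalIntegral.integral_congr (g := fun v => (c e * x p) * ((cut n v : ℂ) *
        deriv (fun v => G.f e v (ι e)) v)), intervalIntegral.integral_const_mul,
        mul_right_comm, hc e, Int.cast_one]
      intro r hr
      rw [uIcc_of_le zero_le_one] at hr
      simp only
      rw [detForm_pull G n ι c ε e p hr, if_pos h, hp r hr]
      ring
    · rw [if_neg h, add_zero]
      exact hconst (p+1) (Or.inr ⟨p, rfl, h⟩) 1 (by simp)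

lemma word_detect (hcut : ∀ e, ∫ v in (0:ℝ)..1, (cut n v : ℂ) * deriv (fun v => G.f e v (ι e)) v ≠ 0)
    (w : G.Lab) (hw : ∀ h : Form G (1 / (n + 4)), ∀ p,
      (G.rho h.J w) (Pi.single 0 1) (p+1) = 0) : w = 1 := by
  classical
  by_contra hne
  set W := Monoid.CoprodI.Word.equiv w with hW
  have hwp : W.prod = w := by
    have := Monoid.CoprodI.Word.equiv.symm_apply_apply w
    exact this
  set L := W.toList with hLdef
  let ε : ℕ → Option G.E := fun p => L.reverse[p]?.map (fun l => l.1)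
  have hε : ∀ p e, ε p = some e → ε (p+1) ≠ some e := by
    intro p e h1 h2
    simp only [ε, Option.map_eq_some_iff] at h1 h2
    obtain ⟨l1, h1, e1⟩ := h1
    obtain ⟨l2, h2, e2⟩ := h2
    have hch := W.chain_ne
    rw [← hLdef, ← L.reverse_reverse, List.isChain_reverse, List.isChain_iff_getElem] at hch
    obtain ⟨b1, h1⟩ := List.getElem?_eq_some_iff.1 h1
    obtain ⟨b2, h2⟩ := List.getElem?_eq_some_iff.1 h2
    have := hch p b2
    rw [h1, h2] at this
    simp [e1, e2] at this
  have hd := detect hε (J := (G.detForm n ι (fun e => (∫ v in (0:ℝ)..1, (cut n v : ℂ) *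
    deriv (fun v => G.f e v (ι e)) v)⁻¹) ε).J)
    (fun e x => detForm_J G n ι (fun e => inv_mul_cancel₀ (hcut e)) hε e x)
    L (fun l hl => W.ne_one l hl) (by
      intro pre l L' h
      simp [ε, h])
  have h2 := hw (G.detForm n ι (fun e => (∫ v in (0:ℝ)..1, (cut n v : ℂ) *
    deriv (fun v => G.f e v (ι e)) v)⁻¹) ε)
  have hLne : L ≠ [] := by
    intro h
    apply hne
    rw [← hwp, Monoid.CoprodI.Word.prod, ← hLdef, h]; rfl
  obtain ⟨m, hm⟩ : ∃ m, L.length = m + 1 := Nat.exists_eq_succ_of_ne_zero (by simpa using hLne)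
  have h3 := hd.1
  rw [hm] at h3
  apply h3
  rw [← h2 m, ← hwp, Monoid.CoprodI.Word.prod, map_list_prod, List.map_map, ← hLdef]
  congr 3
end det

lemma uc_word (G : Gr Γ p₀) (hA : Adm Γ α) {T : ℝ} (hT : 0 < T)
    (h0 : PA α 0 = p₀) (h1 : PA α T = p₀) (hh : polyHull Γ = Γ)
    (hU : ∀ l : List (Fin k), l ≠ [] → II α l T = 0) :
    ∃ N : ℕ, ∀ n ≥ N, G.word (fun j => PA α (j * (T / n))) n = 1 := by
  obtain ⟨ι, m, hm⟩ := exists_cut G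
  have hκ : (0:ℝ) < 1 / (m + 4) := by positivity
  have hκ' : (1:ℝ) / (m + 4) ≤ 1 / 4 := by
    apply one_div_le_one_div_of_le (by norm_num); linarith [m.cast_nonneg (α := ℝ)]
  obtain ⟨N, hN⟩ := holo G hA hκ hκ' hT h0 h1
  refine ⟨N, fun n hn => word_detect G m ι hm _ fun h p => ?_⟩
  rw [← hN n hn h, Tr_apply]
  exact cont_sol hA G.isCompact hh (null_of_gr G) hU _ h.cont p
end UC
end

noncomputable section
namespace UC
open Set Filter Topology

section pi
variable {X : Type*} [TopologicalSpace X] {x0 : X}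

def seg (s t : ℝ) : Path.Homotopic.Quotient s t :=
  Path.Homotopic.Quotient.mk (PathConnectedSpace.somePath s t)

def LL (c : ∀ z : X, Path.Homotopic.Quotient x0 z) (g : C(ℝ, X)) (s t : ℝ) :
    FundamentalGroup X x0 :=
  ((c (g s)).trans ((seg s t).map g)).trans (c (g t)).symm

variable (c : ∀ z : X, Path.Homotopic.Quotient x0 z)

lemma qmap_trans {Y : Type*} [TopologicalSpace Y] {a b d : Y} (p : Path.Homotopic.Quotient a b)
    (q : Path.Homotopic.Quotient b d) (g : C(Y, X)) :
    (p.trans q).map g = (p.map g).trans (q.map g) :=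
  (FundamentalGroupoid.map g).map_comp (X := ⟨a⟩) (Y := ⟨b⟩) (Z := ⟨d⟩) p q

lemma LL_mul (g : C(ℝ, X)) (s t u : ℝ) : LL c g t u * LL c g s t = LL c g s u := by
  rw [FundamentalGroup.mul_def]
  unfold LL
  have : seg s u = (seg s t).trans (seg t u) := Subsingleton.elim _ _
  rw [this, qmap_trans]
  simp only [Path.Homotopic.Quotient.trans_assoc]
  rw [← Path.Homotopic.Quotient.trans_assoc (c (g t)).symm, Path.Homotopic.Quotient.symm_trans,
    Path.Homotopic.Quotient.refl_trans]

lemma LL_self (g : C(ℝ, X)) (s : ℝ) : LL c g s s = 1 := by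
  have := LL_mul c g s s s
  exact mul_eq_left.1 this

lemma LL_inv (g : C(ℝ, X)) (s t : ℝ) : (LL c g s t)⁻¹ = LL c g t s := by
  rw [inv_eq_iff_mul_eq_one, LL_mul, LL_self]

lemma LL_comp (g : C(ℝ, X)) (h : C(ℝ, ℝ)) (s t : ℝ) : LL c (g.comp h) s t = LL c g (h s) (h t) := by
  unfold LL
  have h1 : seg (h s) (h t) = (seg s t).map h := Subsingleton.elim _ _
  rw [h1]
  have h2 : (seg s t).map (g.comp h) = ((seg s t).map h).map g := by
    rfl
  rw [h2]
  rfl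

def clm (s t : ℝ) : C(ℝ, ℝ) := ⟨fun r => max (min s t) (min (max s t) r), by fun_prop⟩

lemma clm_mem (s t r : ℝ) : clm s t r ∈ uIcc s t := by
  simp only [clm, ContinuousMap.coe_mk, uIcc, mem_Icc]
  exact ⟨le_max_left _ _, max_le (min_le_max) (min_le_left _ _)⟩

lemma clm_left (s t : ℝ) : clm s t s = s := by
  simp [clm]

lemma clm_right (s t : ℝ) : clm s t t = t := by
  simp [clm]

lemma LL_congr {g g' : C(ℝ, X)} {s t : ℝ} (h : ∀ r ∈ uIcc s t, g r = g' r) :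
    LL c g s t = LL c g' s t := by
  have e : g.comp (clm s t) = g'.comp (clm s t) := by
    ext r
    exact h _ (clm_mem s t r)
  have := congrArg (fun g => LL c g s t) e
  simpa only [LL_comp, clm_left, clm_right] using this

lemma LL_const {g : C(ℝ, X)} {s t : ℝ} (h : ∀ r ∈ uIcc s t, g r = g s) : LL c g s t = 1 := by
  have h1 : LL c g s t = LL c (g.comp (ContinuousMap.const ℝ s)) s t :=
    LL_congr c (fun r hr => h r hr)
  rw [h1, LL_comp]
  exact LL_self _ _ _

lemma q_aux (y z : X) (hy : y = x0) (hz : z = x0) (q : Path.Homotopic.Quotient x0 x0)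
    (h : ((c y).trans (q.cast hy hz)).trans (c z).symm = Path.Homotopic.Quotient.refl x0) :
    q = Path.Homotopic.Quotient.refl x0 := by
  subst hy
  subst hz
  rw [Path.Homotopic.Quotient.cast_rfl_rfl] at h
  have h2 : ((FundamentalGroup.fromPath (c z))⁻¹ * FundamentalGroup.fromPath q) *
    FundamentalGroup.fromPath (c z) = 1 := by
    have := h
    rw [Path.Homotopic.Quotient.trans_assoc] at this
    rw [Path.Homotopic.Quotient.trans_assoc] at h
    exact this
  have h3 : FundamentalGroup.fromPath q = 1 := by
    have := h2
    rw [mul_eq_one_iff_eq_inv, inv_mul_eq_iff_eq_mul] at this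
    rw [this]; simp
  exact h3

lemma LL_one_homotopic {g : C(ℝ, X)} {T : ℝ} (γ : Path x0 x0) (hγ : ∀ r, γ r = g (T * r))
    (h : LL c g 0 T = 1) : γ.Homotopic (Path.refl x0) := by
  let p : Path (0:ℝ) T := ⟨⟨fun r => T * r, by fun_prop⟩, by simp, by simp⟩
  have h0 : g 0 = x0 := by have := hγ 0; simp at this; exact this.symm
  have h1 : g T = x0 := by have := hγ 1; simp at this; exact this.symm
  have e : seg 0 T = Path.Homotopic.Quotient.mk p := Subsingleton.elim _ _
  have e2 : (seg 0 T).map g = (Path.Homotopic.Quotient.mk γ).cast h0 h1 := by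
    rw [e, ← Path.Homotopic.Quotient.mk_map, ← Path.Homotopic.Quotient.mk_cast]
    congr 1
    ext r
    simp [hγ, p]
  unfold LL at h
  rw [e2] at h
  have := q_aux c _ _ h0 h1 _ h
  exact Path.Homotopic.Quotient.exact this
end pi

end UC
end

noncomputable section
namespace UC
open Set Filter Topology

def th (u : ℝ) : ℝ := cl (2 * u - 1/2)

lemma th_cont : Continuous th := by
  unfold th
  exact cl_lip.continuous.comp (by fun_prop)

lemma th_low {u : ℝ} (h : u ≤ 1/4) : th u = 0 := by
  unfold th cl
  rw [min_eq_right (by linarith), max_eq_left (by linarith)]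

lemma th_high {u : ℝ} (h : 3/4 ≤ u) : th u = 1 := by
  unfold th cl
  rw [min_eq_left (by linarith), max_eq_right (by linarith)]

section
variable {k : ℕ} {Γ : Set (Fin k → ℂ)} {p₀ : Fin k → ℂ} {α : Fin k → ℝ → ℂ}

def Gr.D (G : Gr Γ p₀) (s : ℝ) (z : Fin k → ℂ) : Fin k → ℂ :=
  G.pst (fun e u => G.f e ((1 - s) * u + s * th u)) id z

lemma Gr.D_f (G : Gr Γ p₀) (s : ℝ) (e : G.E) {u : ℝ} (hu : u ∈ Icc (0:ℝ) 1) :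
    G.D s (G.f e u) = G.f e ((1 - s) * u + s * th u) := by
  rw [Gr.D, G.pst_Icc _ _ _ _ e hu]
  · intro e; simp [th_low]
  · intro e; rw [th_high (by norm_num)]; simp

lemma Gr.D_mem (G : Gr Γ p₀) (s : ℝ) {z : Fin k → ℂ} (hz : z ∈ Γ) : G.D s z ∈ Γ := by
  obtain ⟨e, u, hu, rfl⟩ := G.exists_coord hz
  rw [G.D_f s e hu]; exact G.mem _ _

lemma Gr.D_zero (G : Gr Γ p₀) {z : Fin k → ℂ} (hz : z ∈ Γ) : G.D 0 z = z := by
  obtain ⟨e, u, hu, rfl⟩ := G.exists_coord hz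
  rw [G.D_f 0 e hu]; simp

lemma Gr.D_base (G : Gr Γ p₀) (s : ℝ) : G.D s p₀ = p₀ := by
  rw [Gr.D, G.pst_not _ _ _ G.base_not]; rfl

lemma Gr.D_cont (G : Gr Γ p₀) :
    ContinuousOn (fun x : ℝ × (Fin k → ℂ) => G.D x.1 x.2) (Icc 0 1 ×ˢ Γ) := by
  have := G.fin
  have h := cont_glue (fun _ : G.E => Icc (0:ℝ) 1 ×ˢ Icc (0:ℝ) 1)
    (fun _ => isCompact_Icc.prod isCompact_Icc) (fun e x => (x.1, G.f e x.2))
    (fun e => (continuous_fst.prodMk ((G.cont e).comp continuous_snd)).continuousOn)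
    (fun x : ℝ × (Fin k → ℂ) => G.D x.1 x.2) (by
      intro e
      have hc : Continuous (fun x : ℝ × ℝ => G.f e ((1 - x.1) * x.2 + x.1 * th x.2)) := by
        have := th_cont
        exact (G.cont e).comp (by fun_prop)
      refine hc.continuousOn.congr ?_
      rintro ⟨s, u⟩ ⟨_, hu⟩
      exact G.D_f s e hu)
  refine h.mono ?_
  rintro ⟨s, z⟩ ⟨hs, hz⟩
  obtain ⟨e, u, hu, rfl⟩ := G.exists_coord hz
  exact mem_iUnion.2 ⟨e, (s, u), ⟨hs, hu⟩, rfl⟩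

def Gr.FE (G : Gr Γ p₀) (e : G.E) : C(ℝ, Γ) := ⟨fun v => ⟨G.f e v, G.mem e v⟩,
  (G.cont e).subtype_mk _⟩

def Gr.BB (G : Gr Γ p₀) (hA : Adm Γ α) : C(ℝ, Γ) := ⟨fun t => ⟨G.D 1 (PA α t), G.D_mem 1 (hA.inΓ t)⟩, by
  refine Continuous.subtype_mk ?_ _
  exact G.D_cont.comp_continuous (f := fun t => ((1:ℝ), PA α t))
    (continuous_const.prodMk hA.cont) (fun t => ⟨by simp, hA.inΓ t⟩)⟩

lemma Gr.D_vert (G : Gr Γ p₀) {z : Fin k → ℂ} (hz : z ∈ Γ) (hm : ¬ G.mid (1/4) z) :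
    G.D 1 z ∈ range (fun x : G.E × Bool => G.f x.1 (if x.2 then 1 else 0)) := by
  obtain ⟨e, u, hu, rfl⟩ := G.exists_coord hz
  rw [G.mid_iff (by norm_num) hu] at hm
  simp only [mem_Icc, not_and_or, not_le] at hm
  rw [G.D_f 1 e hu]
  rcases hm with hm | hm
  · exact ⟨(e, false), by simp [th_low hm.le]⟩
  · exact ⟨(e, true), by rw [th_high (by linarith)]; simp⟩

variable {x0 : Γ} (c : ∀ z : Γ, Path.Homotopic.Quotient x0 z) (G : Gr Γ p₀)

def Gr.PsiP (z : Fin k → ℂ) : FundamentalGroup Γ x0 :=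
  G.pst (fun e u => LL c (G.FE e) (chi u) (th u)) (fun _ => 1) z

lemma Gr.PsiP_one {z : Fin k → ℂ} (hz : ¬ G.mid (1/4) z) : G.PsiP c z = 1 := by
  by_cases hc : ∃ e, ∃ u ∈ Ioo (0:ℝ) 1, G.f e u = z
  · obtain ⟨e, u, hu, rfl⟩ := hc
    rw [Gr.PsiP, G.pst_Ioo _ _ _ hu]
    rw [G.mid_iff (by norm_num) (Ioo_subset_Icc_self hu)] at hz
    simp only [mem_Icc, not_and_or, not_le] at hz
    rcases hz with hz | hz
    · rw [th_low hz.le, chi, if_pos (by linarith), Int.cast_zero, LL_self]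
    · rw [th_high (by linarith), chi, if_neg (by linarith), Int.cast_one, LL_self]
  · push Not at hc
    rw [Gr.PsiP, G.pst_not _ _ _ hc]

lemma LL_edge {X : Type*} [TopologicalSpace X] {x0 : X} (c : ∀ z : X, Path.Homotopic.Quotient x0 z)
    (g : C(ℝ, X)) (u v u' v' : ℝ) :
    LL c g u' v' = LL c g (chi v) v' * LL c g 0 1 ^ (chi v - chi u) *
      (LL c g (chi u) u')⁻¹ := by
  have h01 : ∀ a b : ℤ, (a = 0 ∨ a = 1) → (b = 0 ∨ b = 1) →
      LL c g 0 1 ^ (b - a) = LL c g a b := by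
    rintro a b (rfl | rfl) (rfl | rfl)
    · simp [LL_self]
    · simp
    · simp [LL_inv]
    · simp [LL_self]
  have hchi : ∀ u, chi u = 0 ∨ chi u = 1 := by
    intro u; unfold chi; split_ifs <;> simp
  rw [h01 _ _ (hchi u) (hchi v), LL_inv, LL_mul, LL_mul]

lemma pi_local (hA : Adm Γ α) (t0 : ℝ) :
    ∃ ε > 0, ∀ s t, |s - t0| < ε → |t - t0| < ε →
      LL c (G.BB hA) s t =
        G.PsiP c (PA α t) * G.rho (fun e => LL c (G.FE e) 0 1) (G.tau (PA α s) (PA α t)) *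
          (G.PsiP c (PA α s))⁻¹ := by
  have hcont := hA.cont
  have hκ : (0:ℝ) < 1/4 := by norm_num
  by_cases hm : G.mid (1/4) (PA α t0)
  · obtain ⟨e, u0, hu0, hAe⟩ := hm
    obtain ⟨δ, hδ, hnear⟩ := G.near_mid hκ
    have hu0' : u0 ∈ Ioo (0:ℝ) 1 := ⟨by linarith [hu0.1], by linarith [hu0.2]⟩
    obtain ⟨ε₁, hε₁, K, hK⟩ := G.inv e u0 hu0'
    obtain ⟨ε, hε, hb⟩ := Metric.continuous_iff.1 hcont t0 (min δ ε₁) (lt_min hδ hε₁)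
    simp only [Real.dist_eq] at hb
    have hu : ∀ t, ∃ v, |t - t0| < ε → v ∈ Ioo (0:ℝ) 1 ∧ G.f e v = PA α t := by
      intro t
      by_cases ht : |t - t0| < ε
      · obtain ⟨v, hv, hv'⟩ := hnear e u0 hu0 (PA α t) (hA.inΓ t) (by
          rw [hAe, dist_comm]; exact (hb t ht).trans_le (min_le_left _ _))
        exact ⟨v, fun _ => ⟨hv, hv'⟩⟩
      · exact ⟨0, fun h => absurd h ht⟩
    choose u hu using hu
    obtain ⟨KA, hKA⟩ := hA.lip
    have hlip : LipschitzOnWith (K * KA) u (Metric.ball t0 ε) := by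
      apply LipschitzOnWith.of_dist_le_mul
      intro s hs t ht
      rw [Metric.mem_ball, Real.dist_eq] at hs ht
      have h1 := hK (u s) (Ioo_subset_Icc_self (hu s hs).1) (u t) (Ioo_subset_Icc_self (hu t ht).1)
        (by rw [(hu s hs).2, hAe]; exact (hb s hs).trans_le (min_le_right _ _))
        (by rw [(hu t ht).2, hAe]; exact (hb t ht).trans_le (min_le_right _ _))
      rw [(hu s hs).2, (hu t ht).2] at h1
      rw [Real.dist_eq]
      refine h1.trans ?_
      push_cast
      rw [mul_assoc]
      gcongr
      exact hKA.dist_le_mul s t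
    refine ⟨ε, hε, fun s t hs ht => ?_⟩
    have hin : ∀ r, clm s t r ∈ Metric.ball t0 ε := fun r =>
      (convex_ball t0 ε).ordConnected.uIcc_subset (x := s) (y := t) hs ht (clm_mem s t r)
    let h : C(ℝ, ℝ) := ⟨fun r => th (u (clm s t r)),
      th_cont.comp (hlip.continuousOn.comp_continuous (clm s t).continuous hin)⟩
    have he : (G.BB hA).comp (clm s t) = (G.FE e).comp h := by
      ext1 r
      apply Subtype.ext
      change G.D 1 (PA α (clm s t r)) = G.f e (th (u (clm s t r)))
      have := hu _ (hin r)
      rw [← this.2, G.D_f 1 e (Ioo_subset_Icc_self this.1)]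
      simp
    have h1 := congrArg (fun g => LL c g s t) he
    simp only [LL_comp, clm_left, clm_right] at h1
    have hhs : h s = th (u s) := by simp only [h, ContinuousMap.coe_mk, clm_left]
    have hht : h t = th (u t) := by simp only [h, ContinuousMap.coe_mk, clm_right]
    rw [h1, hhs, hht]
    rw [← (hu s hs).2, ← (hu t ht).2, G.tau_edge e (hu s hs).1 (hu t ht).1, G.rho_lab, Gr.PsiP,
      Gr.PsiP, G.pst_Ioo _ _ _ (hu s hs).1, G.pst_Ioo _ _ _ (hu t ht).1]
    exact LL_edge c _ _ _ _ _
  · obtain ⟨δ, hδ, hfar⟩ := G.tau_far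
    have ho : ∀ᶠ t in 𝓝 t0, ¬ G.mid (1/4) (PA α t) := by
      have := (G.mid_closed (1/4)).isOpen_compl.preimage hcont
      exact this.mem_nhds hm
    obtain ⟨ε₁, hε₁, h1⟩ := Metric.eventually_nhds_iff.1 ho
    obtain ⟨ε₂, hε₂, h2⟩ := Metric.continuous_iff.1 hcont t0 (δ/2) (by positivity)
    refine ⟨min ε₁ ε₂, lt_min hε₁ hε₂, fun s t hs ht => ?_⟩
    have hms : ¬ G.mid (1/4) (PA α s) := h1 (by rw [Real.dist_eq]; exact hs.trans_le (min_le_left _ _))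
    have hmt : ¬ G.mid (1/4) (PA α t) := h1 (by rw [Real.dist_eq]; exact ht.trans_le (min_le_left _ _))
    rw [hfar _ _ ?_ hms hmt, G.PsiP_one c hms, G.PsiP_one c hmt]
    · simp only [map_one, mul_one, inv_one]
      apply LL_const
      have hball : ∀ r ∈ uIcc s t, ¬ G.mid (1/4) (PA α r) := by
        intro r hr
        have hr' : |r - t0| < min ε₁ ε₂ :=
          (convex_ball t0 (min ε₁ ε₂)).ordConnected.uIcc_subset (x := s) (y := t) hs ht hr
        exact h1 (by rw [Real.dist_eq]; exact hr'.trans_le (min_le_left _ _))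
      intro r hr
      have := G.fin
      apply Subtype.ext
      have hfin : Finite (range (fun x : G.E × Bool => G.f x.1 (if x.2 then 1 else 0))) :=
        Set.finite_range _
      exact (isPreconnected_uIcc (a := s) (b := t)).constant_of_mapsTo
        (T := range (fun x : G.E × Bool => G.f x.1 (if x.2 then 1 else 0)))
        (f := fun t => ((G.BB hA t : Γ) : Fin k → ℂ))
        ⟨inferInstance⟩ (continuous_subtype_val.comp (G.BB hA).continuous).continuousOn
        (fun r hr => G.D_vert (hA.inΓ r) (hball r hr)) hr left_mem_uIcc
    · have a1 := h2 s (by rw [Real.dist_eq]; exact hs.trans_le (min_le_right _ _))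
      have a2 := h2 t (by rw [Real.dist_eq]; exact ht.trans_le (min_le_right _ _))
      linarith [dist_triangle_right (PA α s) (PA α t) (PA α t0)]

lemma pi_one (hA : Adm Γ α) {T : ℝ} (hT : 0 < T)
    (h0 : PA α 0 = p₀) (h1 : PA α T = p₀)
    (hw : ∃ N : ℕ, ∀ n ≥ N, G.word (fun j => PA α (j*(T/n))) n = 1) :
    LL c (G.BB hA) 0 T = 1 := by
  choose ε hε hloc using pi_local c G hA
  obtain ⟨N, hN0, hN⟩ := leb hT ε hε
  obtain ⟨N', hN'⟩ := hw
  let n := max N N'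
  have hn : N ≤ n := le_max_left _ _
  have hn0 : (n:ℝ) ≠ 0 := by
    have : 0 < n := lt_of_lt_of_le hN0 hn
    exact_mod_cast this.ne'
  have := G.word_tel (G.rho (fun e => LL c (G.FE e) 0 1)) (fun j => PA α (j * (T / n)))
    (fun j => G.PsiP c (PA α (j * (T / n))))
    (fun j => LL c (G.BB hA) 0 (j * (T / n)))
    (fun j => LL c (G.BB hA) (j * (T / n)) ((j+1 : ℕ) * (T / n)))
    (by simp [LL_self]) (fun j => by rw [LL_mul]) n (by
      intro j hj
      obtain ⟨t0, ht1, ht2⟩ := hN n hn j hj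
      exact hloc t0 _ _ ht1 ht2)
  simp only [Nat.cast_zero, zero_mul] at this
  rw [mul_div_cancel₀ _ hn0] at this
  rw [this, h0, h1, hN' n (le_max_right _ _)]
  simp

lemma word_homotopic (hA : Adm Γ α) {T : ℝ} (hT : 0 < T)
    (h0 : PA α 0 = p₀) (h1 : PA α T = p₀) (hΓ : PA α '' Icc 0 T = Γ)
    (hw : ∃ N : ℕ, ∀ n ≥ N, G.word (fun j => PA α (j*(T/n))) n = 1) :
    ∃ H : ℝ × ℝ → (Fin k → ℂ),
          Continuous H ∧
          (∀ p, H p ∈ Γ) ∧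
          (∀ x ∈ Set.Icc (0 : ℝ) T, H (0, x) = PA α x) ∧
          (∀ x ∈ Set.Icc (0 : ℝ) T, H (1, x) = p₀) ∧
          (∀ s ∈ Set.Icc (0 : ℝ) 1, H (s, 0) = p₀ ∧ H (s, T) = p₀) := by
  have hp : p₀ ∈ Γ := h0 ▸ hA.inΓ 0
  let x0 : Γ := ⟨p₀, hp⟩
  have hc : ∀ z : Γ, Nonempty (Path x0 z) := by
    rintro ⟨z, hz⟩
    rw [← hΓ] at hz
    obtain ⟨t, ht, rfl⟩ := hz
    exact ⟨⟨⟨fun r => ⟨PA α (t * r), hA.inΓ _⟩, (hA.cont.comp (by fun_prop)).subtype_mk _⟩,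
      by apply Subtype.ext; simp [x0, h0], by apply Subtype.ext; simp⟩⟩
  let c : ∀ z : Γ, Path.Homotopic.Quotient x0 z := fun z => .mk (hc z).some
  have hL := pi_one c G hA hT h0 h1 hw
  let γB : Path x0 x0 := ⟨⟨fun r => G.BB hA (T * r), by fun_prop⟩,
    by apply Subtype.ext; simp [x0, Gr.BB, h0, G.D_base],
    by apply Subtype.ext; simp [x0, Gr.BB, h1, G.D_base]⟩
  let γA : Path x0 x0 := ⟨⟨fun r => ⟨PA α (T * r), hA.inΓ _⟩,
    (hA.cont.comp (by fun_prop)).subtype_mk _⟩,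
    by apply Subtype.ext; simp [x0, h0],
    by apply Subtype.ext; simp [x0, h1]⟩
  have hB : γB.Homotopic (Path.refl x0) := LL_one_homotopic c γB (fun r => rfl) hL
  have hAB : γA.Homotopic γB := by
    refine ⟨⟨⟨⟨fun x => ⟨G.D x.1 (PA α (T * x.2)), G.D_mem _ (hA.inΓ _)⟩, ?_⟩, ?_, ?_⟩, ?_⟩⟩
    · refine Continuous.subtype_mk ?_ _
      exact G.D_cont.comp_continuous
        (f := fun x : unitInterval × unitInterval => ((x.1:ℝ), PA α (T * x.2)))
        ((by fun_prop : Continuous fun x : unitInterval × unitInterval => (x.1:ℝ)).prodMk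
          (hA.cont.comp (by fun_prop))) (fun t => ⟨t.1.2, hA.inΓ _⟩)
    · intro r
      apply Subtype.ext
      exact G.D_zero (hA.inΓ _)
    · intro r
      apply Subtype.ext
      rfl
    · rintro s r (rfl | rfl)
      · apply Subtype.ext
        simp [γA, h0, G.D_base]
      · apply Subtype.ext
        simp [γA, h1, G.D_base]
  obtain ⟨F⟩ := hAB.trans hB
  let q : ℝ → unitInterval := projIcc 0 1 zero_le_one
  have hq : Continuous q := continuous_projIcc
  have hq0 : q 0 = 0 := projIcc_left _
  have hq1 : q 1 = 1 := projIcc_right _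
  refine ⟨fun x => F (q x.1, q (x.2 / T)), ?_, fun p => Subtype.coe_prop _, ?_, ?_, ?_⟩
  · fun_prop
  · intro x hx
    have hm : x / T ∈ Icc (0:ℝ) 1 := ⟨div_nonneg hx.1 hT.le, (div_le_one hT).2 hx.2⟩
    simp only [hq0]
    rw [F.apply_zero]
    have : q (x / T) = ⟨x / T, hm⟩ := projIcc_of_mem _ hm
    simp only [this]
    change PA α (T * (x / T)) = _
    rw [mul_div_cancel₀ _ hT.ne']
  · intro x hx
    simp only [hq1]
    rw [F.apply_one]
    rfl
  · intro s hs
    simp only [zero_div, div_self hT.ne', hq0, hq1]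
    rw [F.source, F.target]
    exact ⟨rfl, rfl⟩
end
end UC
end

noncomputable section
namespace UC
open Set Filter Topology

def al (T : ℝ) (a : ℕ → ℝ → ℂ) (k : ℕ) (i : Fin k) : ℝ → ℂ := (Icc 0 T).indicator (a (i.1 + 1))

lemma al_eq {T : ℝ} {a : ℕ → ℝ → ℂ} {k : ℕ} (i : Fin k) {t : ℝ} (ht : t ∈ Icc 0 T) :
    al T a k i t = a (i.1 + 1) t := by
  rw [al, indicator_of_mem ht]

lemma PA_al {T : ℝ} {a : ℕ → ℝ → ℂ} {k : ℕ} {t : ℝ} (ht : t ∈ Icc 0 T) :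
    PA (al T a k) t = pathA T a k t := by
  funext i
  simp only [PA, pathA]
  refine intervalIntegral.integral_congr fun r hr => ?_
  rw [uIcc_of_le ht.1] at hr
  exact al_eq i ⟨hr.1, hr.2.trans ht.2⟩

lemma al_adm {T : ℝ} (hT : 0 < T) {a : ℕ → ℝ → ℂ} (ha : MemX T a) (k : ℕ) :
    Adm (pathA T a k '' Icc 0 T) (al T a k) := by
  obtain ⟨hm, C, hC⟩ := ha
  have meas : ∀ i, Measurable (al T a k i) := fun i => (hm _).indicator measurableSet_Icc
  let D : NNReal := ∑ i : Fin k, ‖C ^ (i.1+1)‖₊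
  have bdd : ∀ i t, ‖al T a k i t‖ ≤ D := by
    intro i t
    by_cases ht : t ∈ Icc 0 T
    · rw [al_eq i ht]
      refine (hC _ (by omega) t ht).trans ?_
      refine (le_abs_self _).trans ?_
      have : ‖C ^ (i.1+1)‖₊ ≤ D :=
        Finset.single_le_sum (f := fun i : Fin k => ‖C ^ (i.1+1)‖₊) (fun _ _ => zero_le) (Finset.mem_univ i)
      exact_mod_cast this
    · rw [al, indicator_of_notMem ht, norm_zero]; positivity
  refine ⟨meas, ⟨D, bdd⟩, fun t => ?_⟩
  have hii : ∀ i s t, IntervalIntegrable (al T a k i) volume s t :=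
    fun i s t => ii_of_bdd (meas i) (bdd i) s t
  by_cases h0 : t < 0
  · refine ⟨0, ⟨le_rfl, hT.le⟩, ?_⟩
    rw [← PA_al ⟨le_rfl, hT.le⟩]
    funext i
    simp only [PA, intervalIntegral.integral_same]
    symm
    rw [intervalIntegral.integral_of_ge h0.le, integral_Ioc_eq_integral_Ioo,
      setIntegral_congr_fun (g := fun _ => (0:ℂ)) measurableSet_Ioo]
    · simp
    · intro r hr
      exact indicator_of_notMem (fun h => absurd h.1 (not_le.2 hr.2)) _
  · by_cases h1 : T < t
    · refine ⟨T, ⟨hT.le, le_rfl⟩, ?_⟩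
      rw [← PA_al ⟨hT.le, le_rfl⟩]
      funext i
      simp only [PA]
      rw [← intervalIntegral.integral_add_adjacent_intervals (hii i 0 T) (hii i T t)]
      have : ∫ r in T..t, al T a k i r = 0 := by
        rw [intervalIntegral.integral_of_le h1.le]
        rw [setIntegral_congr_fun (g := fun _ => (0:ℂ)) measurableSet_Ioc]
        · simp
        · intro r hr
          exact indicator_of_notMem (fun h => absurd h.2 (not_le.2 hr.1)) _
      rw [this, add_zero]
    · push Not at h0 h1
      exact ⟨t, ⟨h0, h1⟩, (PA_al ⟨h0, h1⟩).symm⟩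

lemma it_al {T : ℝ} {a : ℕ → ℝ → ℂ} {k : ℕ} (l : List (Fin k)) :
    ∀ x ∈ Icc 0 T, itIntAux a (l.map (fun i => i.1 + 1)) x = II (al T a k) l x := by
  induction l with
  | nil => intro x _; rfl
  | cons i l ih =>
    intro x hx
    simp only [List.map_cons, itIntAux, II]
    refine intervalIntegral.integral_congr fun r hr => ?_
    rw [uIcc_of_le hx.1] at hr
    have hr' : r ∈ Icc 0 T := ⟨hr.1, hr.2.trans hx.2⟩
    simp only [al_eq i hr', ih r hr']

lemma it_big {a : ℕ → ℝ → ℂ} {k : ℕ} (hXk : ∀ j, k < j → a j = 0) (l : List ℕ)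
    (h : ∃ j ∈ l, k < j) : ∀ x, itIntAux a l x = 0 := by
  induction l with
  | nil => simp at h
  | cons i l ih =>
    intro x
    simp only [itIntAux]
    by_cases hi : k < i
    · simp [hXk i hi]
    · have : ∃ j ∈ l, k < j := by
        obtain ⟨j, hj, hk⟩ := h
        rcases List.mem_cons.1 hj with rfl | hj
        · exact absurd hk hi
        · exact ⟨j, hj, hk⟩
      simp [ih this]

lemma list_lift {k : ℕ} (l : List ℕ) (h1 : ∀ i ∈ l, 1 ≤ i) (h2 : ∀ i ∈ l, i ≤ k) :
    ∃ m : List (Fin k), m.map (fun i => i.1 + 1) = l := by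
  induction l with
  | nil => exact ⟨[], rfl⟩
  | cons i l ih =>
    obtain ⟨m, hm⟩ := ih (fun i hi => h1 i (List.mem_cons_of_mem _ hi))
      (fun i hi => h2 i (List.mem_cons_of_mem _ hi))
    have a1 := h1 i List.mem_cons_self
    have a2 := h2 i List.mem_cons_self
    exact ⟨⟨i - 1, by omega⟩ :: m, by simp [hm]; omega⟩

lemma uc_iff {T : ℝ} (hT : 0 < T) {a : ℕ → ℝ → ℂ} {k : ℕ} (hXk : ∀ j, k < j → a j = 0) :
    IsUnivCenter T a ↔ ∀ l : List (Fin k), l ≠ [] → II (al T a k) l T = 0 := by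
  constructor
  · intro h l hl
    have := h (l.map (fun i => i.1+1)).reverse (by simpa using hl) (by simp)
    rw [itInt, List.reverse_reverse, it_al l T ⟨hT.le, le_rfl⟩] at this
    exact this
  · intro h l hl h1
    by_cases hb : ∃ j ∈ l, k < j
    · rw [itInt]
      exact it_big hXk _ (by simpa using hb) T
    · push Not at hb
      obtain ⟨m, hm⟩ := list_lift (k := k) l.reverse (by simpa using h1) (by simpa using hb)
      rw [itInt, ← hm, it_al m T ⟨hT.le, le_rfl⟩]
      apply h
      rintro rfl
      simp at hm
      exact hl hm

lemma sol_II {k : ℕ} (α : Fin k → ℝ → ℂ) (ℓ : ℕ → Fin k) (l : List (Fin k))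
    (h : ∀ p < l.length, l.reverse[p]? = some (ℓ p)) (x : ℝ) :
    sol (fun p => α (ℓ p)) 0 (fun p => if p = 0 then 1 else 0) l.length x = II α l x := by
  induction l generalizing x with
  | nil => simp [sol, II]
  | cons i l ih =>
    have ih' := ih (fun p hp => by
      have := h p (by simp; omega)
      rw [List.reverse_cons, List.getElem?_append_left (by simpa using hp)] at this
      exact this)
    have hi : ℓ l.length = i := by
      have := h l.length (by simp)
      rw [List.reverse_cons, List.getElem?_append_right (by simp)] at this
      simpa using this.symm
    simp only [List.length_cons, sol, II, hi]
    simp [ih']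

end UC
end

/-- if `Γ_k = A_k([0,T])` is a Lipschitz triangulable curve equal to its own
polynomially convex hull, then `a` is a universal center iff `A_k` is a loop which is
null-homotopic inside `Γ_k` (through loops based at `A_k(0)`). -/
theorem univCenter_iff_nullhomotopic_in_curve (T : ℝ) (hT : 0 < T) (a : ℕ → ℝ → ℂ)
    (ha : MemX T a) (k : ℕ) (hXk : ∀ j, k < j → a j = 0)
    (htri : LipTriangulable (pathA T a k '' Set.Icc 0 T))
    (hhull : polyHull (pathA T a k '' Set.Icc 0 T) = pathA T a k '' Set.Icc 0 T) :
    IsUnivCenter T a ↔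
      (pathA T a k 0 = pathA T a k T ∧
        ∃ H : ℝ × ℝ → (Fin k → ℂ),
          ContinuousOn H (Set.Icc 0 1 ×ˢ Set.Icc 0 T) ∧
          (∀ p ∈ Set.Icc (0 : ℝ) 1 ×ˢ Set.Icc (0 : ℝ) T,
            H p ∈ pathA T a k '' Set.Icc 0 T) ∧
          (∀ x ∈ Set.Icc (0 : ℝ) T, H (0, x) = pathA T a k x) ∧
          (∀ x ∈ Set.Icc (0 : ℝ) T, H (1, x) = pathA T a k 0) ∧
          (∀ s ∈ Set.Icc (0 : ℝ) 1,
            H (s, 0) = pathA T a k 0 ∧ H (s, T) = pathA T a k 0)) := by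
  have hA := UC.al_adm hT ha k
  have e0 : UC.PA (UC.al T a k) 0 = pathA T a k 0 := UC.PA_al ⟨le_rfl, hT.le⟩
  have eT : UC.PA (UC.al T a k) T = pathA T a k T := UC.PA_al ⟨hT.le, le_rfl⟩
  obtain ⟨G⟩ := UC.exists_gr (pathA T a k 0) htri
  rw [UC.uc_iff hT hXk]
  constructor
  · intro hU
    have hl : pathA T a k 0 = pathA T a k T := by
      rw [← eT]
      funext i
      have := hU [i] (by simp)
      simp only [UC.II, mul_one] at this
      simp only [UC.PA, pathA]
      rw [this]; simp
    have hw := UC.uc_word G hA hT e0 (eT.trans hl.symm) hhull hU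
    obtain ⟨H, hH, h1, h2, h3, h4⟩ := UC.word_homotopic G hA hT e0 (eT.trans hl.symm)
      (Set.image_congr fun t ht => UC.PA_al ht) hw
    exact ⟨hl, H, hH.continuousOn, fun p _ => h1 p, fun x hx => (h2 x hx).trans (UC.PA_al hx),
      h3, h4⟩
  · rintro ⟨hl, H, hH, h1, h2, h3, h4⟩ l hne
    have hw := G.word_homotopy hT (UC.PA (UC.al T a k)) H hH h1
      (fun x hx => (h2 x hx).trans (UC.PA_al hx).symm) (by rw [e0]; exact h3) (by rw [e0]; exact h4)
    obtain ⟨i0, l', rfl⟩ := List.exists_cons_of_ne_nil hne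
    set l := i0 :: l' with hl'
    have := UC.word_one_imp G hA hT e0 (eT.trans hl.symm) hw (fun p => l.reverse.getD p i0)
      (fun p => if p = 0 then 1 else 0) l.length
    rw [UC.sol_II] at this
    · rw [this]; simp [hl']
    · intro p hp
      rw [List.getD_eq_getElem?_getD, List.getElem?_eq_getElem (by simpa using hp)]
      simp
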